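/- Let n ≥ 2, integers a, b ≥ 0 and 0 < r < n. The ℂ-vector space ℋℳ^{(r)}_{a,b} of Hermitean monogenic homogeneous polynomials of bidegree (a,b) from ℂⁿ to (∧_n†)^{(r)} I has finite dimension m^{(r)}_{a,b} = ((a+b+n) r / ((a+r)(b+n−r))) · C(n−1, r) · C(a+n−1, a) · C(b+n−1, b), where C(·,·) denotes the binomial coefficient. -/

import Mathlib

noncomputable section

/-- The negative definite quadratic form `-∑ vᵢ²` on `K^m`. -/
def negQ (K : Type) [Field K] (m : ℕ) : QuadraticForm K (Fin m → K) :=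
  QuadraticMap.weightedSumSquares K (fun _ : Fin m => (-1 : K))

/-- The complex Clifford algebra `ℂ_{2n}`, generated by `e_1, …, e_{2n}` with
`e_α e_β + e_β e_α = -2 δ_{αβ}`. -/
abbrev Cl (n : ℕ) : Type := CliffordAlgebra (negQ ℂ (n + n))

/-- The generators `e_α`, `α = 1, …, 2n`, of `ℂ_{2n}`. -/
def e (n : ℕ) (α : Fin (n + n)) : Cl n := CliffordAlgebra.ι (negQ ℂ (n + n)) (Pi.single α 1)

/-- The Witt basis element `𝔣_j = ½(e_j - i e_{n+j})`. -/
def ff (n : ℕ) (j : Fin n) : Cl n :=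
  (2⁻¹ : ℂ) • (e n (Fin.castAdd n j) - Complex.I • e n (Fin.natAdd n j))

/-- The Witt basis element `𝔣_j† = -½(e_j + i e_{n+j})`. -/
def ffd (n : ℕ) (j : Fin n) : Cl n :=
  -((2⁻¹ : ℂ) • (e n (Fin.castAdd n j) + Complex.I • e n (Fin.natAdd n j)))

/-- `f : ℂ^m → ℂ_{2n}` has directional derivative `d` at `z` in direction `v`
(componentwise, i.e. tested against all linear functionals on the finite-dimensional
space `ℂ_{2n}`; here `ℂ^m` is regarded as the real vector space `ℝ^{2m}`). -/
def HasDirDeriv {n m : ℕ} (f : (Fin m → ℂ) → Cl n) (z v : Fin m → ℂ) (d : Cl n) : Prop :=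
  ∀ φ : Cl n →ₗ[ℂ] ℂ, HasDerivAt (fun t : ℝ => φ (f (z + t • v))) (φ d) 0

/-- The directional derivative of `f` at `z` in direction `v` (junk value if none exists). -/
def dirDeriv {n m : ℕ} (f : (Fin m → ℂ) → Cl n) (v : Fin m → ℂ) (z : Fin m → ℂ) : Cl n :=
  letI : Nonempty (Cl n) := ⟨0⟩
  Classical.epsilon fun d => HasDirDeriv f z v d

/-- The Cauchy–Riemann operator `∂_{z_j} = ½(∂_{x_j} - i ∂_{y_j})`. -/
def pz {n m : ℕ} (j : Fin m) (f : (Fin m → ℂ) → Cl n) : (Fin m → ℂ) → Cl n := fun z =>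
  (2⁻¹ : ℂ) • (dirDeriv f (Pi.single j 1) z - Complex.I • dirDeriv f (Pi.single j Complex.I) z)

/-- The conjugate Cauchy–Riemann operator `∂_{z_j^c} = ½(∂_{x_j} + i ∂_{y_j})`. -/
def pzc {n m : ℕ} (j : Fin m) (f : (Fin m → ℂ) → Cl n) : (Fin m → ℂ) → Cl n := fun z =>
  (2⁻¹ : ℂ) • (dirDeriv f (Pi.single j 1) z + Complex.I • dirDeriv f (Pi.single j Complex.I) z)

/-- The Hermitean Dirac operator `∂_z g = ∑_j 𝔣_j† ∂_{z_j} g` on functions `ℂ^n → ℂ_{2n}`. -/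
def dzFull (n : ℕ) (g : (Fin n → ℂ) → Cl n) (z : Fin n → ℂ) : Cl n :=
  ∑ j : Fin n, ffd n j * pz j g z

/-- The Hermitean Dirac operator `∂_z† g = ∑_j 𝔣_j ∂_{z_j^c} g` on functions `ℂ^n → ℂ_{2n}`. -/
def dzdFull (n : ℕ) (g : (Fin n → ℂ) → Cl n) (z : Fin n → ℂ) : Cl n :=
  ∑ j : Fin n, ff n j * pzc j g z

/-- `g : ℂ^n → ℂ_{2n}` is Hermitean monogenic (everywhere). -/
def HMonogenic (n : ℕ) (g : (Fin n → ℂ) → Cl n) : Prop :=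
  ∀ z, dzFull n g z = 0 ∧ dzdFull n g z = 0

/-- The restricted Hermitean Dirac operator `∂_z̃ g = ∑_{j<n} 𝔣_j† ∂_{z_j} g` on functions
`ℂ^{n-1} → ℂ_{2n}`. -/
def dzT (n : ℕ) (g : (Fin (n - 1) → ℂ) → Cl n) (z : Fin (n - 1) → ℂ) : Cl n :=
  ∑ j : Fin (n - 1), ffd n (Fin.castLE (Nat.sub_le n 1) j) * pz j g z

/-- The restricted Hermitean Dirac operator `∂_z̃† g = ∑_{j<n} 𝔣_j ∂_{z_j^c} g` on functions
`ℂ^{n-1} → ℂ_{2n}`. -/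
def dzdT (n : ℕ) (g : (Fin (n - 1) → ℂ) → Cl n) (z : Fin (n - 1) → ℂ) : Cl n :=
  ∑ j : Fin (n - 1), ff n (Fin.castLE (Nat.sub_le n 1) j) * pzc j g z

/-- `p : ℂ^m → ℂ_{2n}` is a polynomial map (in the underlying real coordinates,
equivalently in `z_j` and their conjugates) with coefficients in `ℂ_{2n}`. -/
def IsPolyMap (n m : ℕ) (p : (Fin m → ℂ) → Cl n) : Prop :=
  ∃ (N : ℕ) (c : Fin N → Cl n) (dx dy : Fin N → Fin m → ℕ),
    ∀ z, p z = ∑ t, (∏ j, (z j) ^ dx t j * (starRingEnd ℂ) (z j) ^ dy t j) • c t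

/-- `p : ℂ^m → ℂ_{2n}` is a homogeneous polynomial of bidegree `(a, b)`:
it is polynomial and `p (c z) = c^a (conj c)^b p(z)`. -/
def IsBihom (n m a b : ℕ) (p : (Fin m → ℂ) → Cl n) : Prop :=
  IsPolyMap n m p ∧ ∀ (c : ℂ) (z : Fin m → ℂ),
    p (c • z) = (c ^ a * (starRingEnd ℂ) c ^ b) • p z

/-- The idempotent `I = (𝔣_1 𝔣_1†)(𝔣_2 𝔣_2†) ⋯ (𝔣_n 𝔣_n†)`. -/
def Iel (n : ℕ) : Cl n := ((List.finRange n).map (fun j => ff n j * ffd n j)).prod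

/-- The element `𝔣_{k_1}† ⋯ 𝔣_{k_r}† I` for `s = {k_1 < ⋯ < k_r}`. -/
def blade (n : ℕ) (s : Finset (Fin n)) : Cl n :=
  ((s.sort (· ≤ ·)).map (ffd n)).prod * Iel n

/-- The homogeneous part `(∧_n†)^{(r)} I` of spinor space. -/
def Lam (n r : ℕ) : Submodule ℂ (Cl n) :=
  Submodule.span ℂ {x | ∃ s : Finset (Fin n), s.card = r ∧ x = blade n s}

/-- The subspace `(∧_{n-1}†)^{(r)}(𝔣_1†,…,𝔣_{n-1}†) I` (all indices `≤ n-1`). -/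
def LamT (n r : ℕ) : Submodule ℂ (Cl n) :=
  Submodule.span ℂ
    {x | ∃ s : Finset (Fin n), s.card = r ∧ (∀ j ∈ s, (j : ℕ) + 1 < n) ∧ x = blade n s}

/-- The subspace `(∧_{n-1}†)^{(r-1)}(𝔣_1†,…,𝔣_{n-1}†) 𝔣_n† I`: the span of the blades
`𝔣_{k_1}† ⋯ 𝔣_{k_{r-1}}† 𝔣_n† I` with `k_1 < ⋯ < k_{r-1} ≤ n-1`, i.e. of the `r`-blades
whose index set contains `n`. -/
def LamQ (n r : ℕ) : Submodule ℂ (Cl n) :=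
  Submodule.span ℂ
    {x | ∃ s : Finset (Fin n), s.card = r ∧ (∃ j ∈ s, (j : ℕ) + 1 = n) ∧ x = blade n s}

/-- The embedding `ℂ^{n-1} ≃ {z ∈ ℂ^n : z_n = 0} ⊆ ℂ^n`. -/
def embC (n : ℕ) (x : Fin (n - 1) → ℂ) : Fin n → ℂ :=
  fun i => if h : (i : ℕ) < n - 1 then x ⟨i, h⟩ else 0

/-! ### The Witt basis and the spinor blades -/

lemma negQ_polar (n : ℕ) (x y : Fin (n + n) → ℂ) :
    QuadraticMap.polar (negQ ℂ (n + n)) x y = -2 * ∑ i, x i * y i := by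
  simp only [QuadraticMap.polar, negQ, QuadraticMap.weightedSumSquares_apply, Pi.add_apply,
    ← Finset.sum_sub_distrib, Finset.mul_sum, smul_eq_mul]
  exact Finset.sum_congr rfl fun i _ => by ring

/-- The vector `e_j + c e_{n+j}`. -/
def wittVec (n : ℕ) (c : ℂ) (j : Fin n) : Fin (n + n) → ℂ :=
  Pi.single (Fin.castAdd n j) 1 + c • Pi.single (Fin.natAdd n j) 1

lemma ff_eq (n : ℕ) (j : Fin n) :
    ff n j = (2⁻¹ : ℂ) • CliffordAlgebra.ι (negQ ℂ (n + n)) (wittVec n (-Complex.I) j) := by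
  simp [ff, e, wittVec, sub_eq_add_neg]

lemma ffd_eq (n : ℕ) (j : Fin n) :
    ffd n j = (-2⁻¹ : ℂ) • CliffordAlgebra.ι (negQ ℂ (n + n)) (wittVec n Complex.I j) := by
  simp [ffd, e, wittVec, add_comm]

lemma castAdd_ne_natAdd (n : ℕ) (j k : Fin n) : Fin.castAdd n j ≠ Fin.natAdd n k := by
  intro h
  have := congrArg Fin.val h
  simp at this
  omega

lemma wittVec_castAdd (n : ℕ) (c : ℂ) (j k : Fin n) :
    wittVec n c j (Fin.castAdd n k) = if k = j then 1 else 0 := by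
  simp [wittVec, Pi.single_apply, castAdd_ne_natAdd, -Fin.natAdd_eq_addNat]

lemma wittVec_natAdd (n : ℕ) (c : ℂ) (j k : Fin n) :
    wittVec n c j (Fin.natAdd n k) = if k = j then c else 0 := by
  simp [wittVec, Pi.single_apply, (castAdd_ne_natAdd _ _ _).symm, -Fin.natAdd_eq_addNat]

lemma sum_wittVec (n : ℕ) (c c' : ℂ) (j k : Fin n) :
    ∑ i, wittVec n c j i * wittVec n c' k i = if j = k then 1 + c * c' else 0 := by
  rw [Fin.sum_univ_add]
  simp only [wittVec_castAdd, wittVec_natAdd]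
  by_cases h : j = k
  · simp [h]
  · simp [h, Ne.symm h]

lemma ι_wittVec_anticomm (n : ℕ) (c c' : ℂ) (j k : Fin n) :
    CliffordAlgebra.ι (negQ ℂ (n + n)) (wittVec n c j) *
        CliffordAlgebra.ι (negQ ℂ (n + n)) (wittVec n c' k) +
      CliffordAlgebra.ι (negQ ℂ (n + n)) (wittVec n c' k) *
        CliffordAlgebra.ι (negQ ℂ (n + n)) (wittVec n c j) =
      (if j = k then -2 * (1 + c * c') else 0 : ℂ) • (1 : Cl n) := by
  rw [CliffordAlgebra.ι_mul_ι_add_swap, negQ_polar, Algebra.algebraMap_eq_smul_one, sum_wittVec]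
  simp only [mul_ite, mul_zero]

lemma ffd_mul_ffd (n : ℕ) (j k : Fin n) : ffd n j * ffd n k + ffd n k * ffd n j = 0 := by
  simp only [ffd_eq, smul_mul_smul_comm, ← smul_add, ι_wittVec_anticomm]
  simp

lemma ff_mul_ff (n : ℕ) (j k : Fin n) : ff n j * ff n k + ff n k * ff n j = 0 := by
  simp only [ff_eq, smul_mul_smul_comm, ← smul_add, ι_wittVec_anticomm]
  simp

lemma ff_mul_ffd (n : ℕ) (j k : Fin n) :
    ff n j * ffd n k + ffd n k * ff n j = (if j = k then 1 else 0 : ℂ) • (1 : Cl n) := by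
  simp only [ff_eq, ffd_eq, smul_mul_smul_comm]
  rw [mul_comm (-2⁻¹ : ℂ), ← smul_add, ι_wittVec_anticomm, smul_smul]
  split_ifs <;> norm_num

lemma self_mul_self_of_anticomm {n : ℕ} {x : Cl n} (h : x * x + x * x = 0) : x * x = 0 := by
  rwa [← two_smul ℂ, smul_eq_zero_iff_right two_ne_zero] at h

/-- The element `𝔣_{k_1}† ⋯ 𝔣_{k_r}† I` for an arbitrary list of indices. -/
def bladeList (n : ℕ) (l : List (Fin n)) : Cl n := (l.map (ffd n)).prod * Iel n

lemma bladeList_cons (n : ℕ) (j : Fin n) (l : List (Fin n)) :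
    bladeList n (j :: l) = ffd n j * bladeList n l := by
  simp [bladeList, mul_assoc]

lemma blade_eq_bladeList (n : ℕ) (s : Finset (Fin n)) :
    blade n s = bladeList n (s.sort (· ≤ ·)) := rfl

lemma ff_mul_Iel (n : ℕ) (j : Fin n) : ff n j * Iel n = 0 := by
  have key : ∀ l : List (Fin n), j ∈ l → ff n j * (l.map fun k => ff n k * ffd n k).prod = 0 := by
    intro l
    induction l with
    | nil => simp
    | cons k l ih =>
      intro hj
      rw [List.map_cons, List.prod_cons]
      by_cases hjk : j = k
      · subst hjk
        rw [← mul_assoc, ← mul_assoc, self_mul_self_of_anticomm (ff_mul_ff n j j), zero_mul,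
          zero_mul]
      · have h1 := eq_neg_of_add_eq_zero_left (ff_mul_ff n j k)
        have h2 : ff n j * ffd n k = -(ffd n k * ff n j) :=
          eq_neg_of_add_eq_zero_left (by simpa [hjk] using ff_mul_ffd n j k)
        have hl := ih ((List.mem_cons.1 hj).resolve_left hjk)
        calc ff n j * (ff n k * ffd n k * (l.map fun k => ff n k * ffd n k).prod)
            = (ff n j * ff n k) * ffd n k * (l.map fun k => ff n k * ffd n k).prod := by
              simp only [mul_assoc]
          _ = -(ff n k * (ff n j * ffd n k) * (l.map fun k => ff n k * ffd n k).prod) := by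
              rw [h1]; simp only [mul_assoc, neg_mul]
          _ = ff n k * ffd n k * (ff n j * (l.map fun k => ff n k * ffd n k).prod) := by
              rw [h2]; simp only [mul_assoc, neg_mul, mul_neg, neg_neg]
          _ = 0 := by rw [hl, mul_zero]
  exact key _ (List.mem_finRange j)

lemma bladeList_perm (n : ℕ) {l l' : List (Fin n)} (h : l.Perm l') :
    bladeList n l = bladeList n l' ∨ bladeList n l = -bladeList n l' := by
  induction h with
  | nil => exact Or.inl rfl
  | cons j _ ih =>
    rcases ih with h | h
    · exact Or.inl (by rw [bladeList_cons, bladeList_cons, h])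
    · exact Or.inr (by rw [bladeList_cons, bladeList_cons, h, mul_neg])
  | swap j k l =>
    refine Or.inr ?_
    simp only [bladeList_cons, ← mul_assoc]
    rw [eq_neg_of_add_eq_zero_left (ffd_mul_ffd n k j), neg_mul]
  | trans _ _ ih ih' => rcases ih with h | h <;> rcases ih' with h' | h' <;> simp [h, h']

lemma blade_mem_Lam (n : ℕ) (s : Finset (Fin n)) : blade n s ∈ Lam n s.card :=
  Submodule.subset_span ⟨s, rfl, rfl⟩

lemma bladeList_eq_zero (n : ℕ) {l : List (Fin n)} (h : ¬ l.Nodup) : bladeList n l = 0 := by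
  obtain ⟨j, hj⟩ := List.exists_duplicate_iff_not_nodup.2 h
  obtain ⟨l', hl'⟩ := (List.duplicate_iff_sublist.1 hj).exists_perm_append
  have h0 : bladeList n ([j, j] ++ l') = 0 := by
    simp only [List.cons_append, List.nil_append, bladeList_cons, ← mul_assoc]
    rw [self_mul_self_of_anticomm (ffd_mul_ffd n j j), zero_mul]
  rcases bladeList_perm n hl' with h | h <;> rw [h, h0]
  exact neg_zero

lemma bladeList_mem_Lam (n : ℕ) (l : List (Fin n)) : bladeList n l ∈ Lam n l.length := by
  by_cases h : l.Nodup
  · have hp : l.Perm (l.toFinset.sort (· ≤ ·)) :=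
      (List.perm_ext_iff_of_nodup h (Finset.sort_nodup _ _)).2 (by simp)
    have hm := blade_mem_Lam n l.toFinset
    rw [List.toFinset_card_of_nodup h, blade_eq_bladeList] at hm
    rcases bladeList_perm n hp with h' | h' <;> rw [h']
    · exact hm
    · exact neg_mem hm
  · rw [bladeList_eq_zero n h]
    exact zero_mem _

lemma Lam_le_comap {n r : ℕ} {f : Cl n →ₗ[ℂ] Cl n} {S : Submodule ℂ (Cl n)}
    (h : ∀ l : List (Fin n), l.length = r → f (bladeList n l) ∈ S) : ∀ x ∈ Lam n r, f x ∈ S := by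
  suffices Lam n r ≤ S.comap f from this
  refine Submodule.span_le.2 ?_
  rintro _ ⟨s, hs, rfl⟩
  exact h _ (by rw [Finset.length_sort, hs])

lemma ffd_mul_mem_Lam {n r : ℕ} (j : Fin n) {x : Cl n} (hx : x ∈ Lam n r) :
    ffd n j * x ∈ Lam n (r + 1) := by
  refine Lam_le_comap (f := LinearMap.mulLeft ℂ (ffd n j)) (fun l hl => ?_) x hx
  rw [LinearMap.mulLeft_apply, ← bladeList_cons, ← hl, ← List.length_cons (a := j)]
  exact bladeList_mem_Lam n _

lemma ff_mul_ffd_mul (n : ℕ) (j k : Fin n) (x : Cl n) :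
    ff n j * (ffd n k * x) = (if j = k then 1 else 0 : ℂ) • x - ffd n k * (ff n j * x) := by
  rw [eq_sub_iff_add_eq, ← mul_assoc, ← mul_assoc, ← add_mul, ff_mul_ffd, smul_mul_assoc, one_mul]

lemma ff_mul_eq_zero {n : ℕ} (j : Fin n) {x : Cl n} (hx : x ∈ Lam n 0) : ff n j * x = 0 := by
  refine (Submodule.mem_bot ℂ).1
    (Lam_le_comap (f := LinearMap.mulLeft ℂ (ff n j)) (S := ⊥) (fun l hl => ?_) x hx)
  rw [List.length_eq_zero_iff.1 hl]
  simp [bladeList, ff_mul_Iel]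

lemma ff_mul_mem_Lam {n r : ℕ} (j : Fin n) {x : Cl n} (hx : x ∈ Lam n (r + 1)) :
    ff n j * x ∈ Lam n r := by
  refine Lam_le_comap (f := LinearMap.mulLeft ℂ (ff n j)) (fun l hl => ?_) x hx
  rw [LinearMap.mulLeft_apply]
  clear hx
  induction r generalizing l with
  | zero =>
    obtain ⟨k, rfl⟩ := List.length_eq_one_iff.1 hl
    rw [bladeList_cons, ff_mul_ffd_mul, ff_mul_eq_zero j (bladeList_mem_Lam n []), mul_zero,
      sub_zero]
    exact Submodule.smul_mem _ _ (bladeList_mem_Lam n [])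
  | succ r ih =>
    obtain _ | ⟨k, l⟩ := l
    · simp at hl
    · have hl' : l.length = r + 1 := by simpa using hl
      rw [bladeList_cons, ff_mul_ffd_mul]
      refine sub_mem (Submodule.smul_mem _ _ ?_) (ffd_mul_mem_Lam k (ih l hl'))
      rw [← hl']
      exact bladeList_mem_Lam n l

/-- A weighted number operator is diagonal on blades. -/
lemma sum_ffd_ff_bladeList (n : ℕ) (c : Fin n → ℂ) (l : List (Fin n)) :
    ∑ j, c j • (ffd n j * (ff n j * bladeList n l)) = (l.map c).sum • bladeList n l := by
  induction l with
  | nil => simp [bladeList, ff_mul_Iel]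
  | cons k l ih =>
    have h : ∀ j, c j • (ffd n j * (ff n j * bladeList n (k :: l))) =
        (if j = k then c j else 0) • bladeList n (k :: l) +
          ffd n k * (c j • (ffd n j * (ff n j * bladeList n l))) := by
      intro j
      rw [bladeList_cons, ff_mul_ffd_mul, mul_sub, ← mul_assoc (ffd n j) (ffd n k),
        eq_neg_of_add_eq_zero_left (ffd_mul_ffd n j k), neg_mul, sub_neg_eq_add, smul_add,
        mul_assoc, mul_smul_comm (c j)]
      congr 1
      split_ifs with hjk
      · rw [hjk, one_smul]
      · simp
    rw [Finset.sum_congr rfl fun j _ => h j, Finset.sum_add_distrib, ← Finset.sum_smul,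
      ← Finset.mul_sum, ih]
    simp [bladeList_cons, add_smul]

lemma sum_ffd_ff_mul {n r : ℕ} {x : Cl n} (hx : x ∈ Lam n r) :
    ∑ j, ffd n j * (ff n j * x) = (r : ℂ) • x := by
  have := Lam_le_comap (r := r) (S := ⊥) (f := (∑ j, LinearMap.mulLeft ℂ (ffd n j) ∘ₗ
    LinearMap.mulLeft ℂ (ff n j)) - (r : ℂ) • LinearMap.id) (fun l hl => ?_) x hx
  · simpa [sub_eq_zero, LinearMap.sum_apply] using this
  · have := sum_ffd_ff_bladeList n (fun _ => 1) l
    simp only [one_smul] at this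
    simp [LinearMap.sum_apply, this, hl]

/-! ### Linear independence of the blades -/

/-- The action of the generators of `ℂ_{2n}` on the exterior algebra of `ℂⁿ`, by which `𝔣_j†`
acts as exterior multiplication and `𝔣_j` as contraction. -/
def spinAct (n : ℕ) : (Fin (n + n) → ℂ) →ₗ[ℂ] Module.End ℂ (ExteriorAlgebra ℂ (Fin n → ℂ)) :=
  ∑ j : Fin n, ((LinearMap.proj (Fin.castAdd n j) + Complex.I • LinearMap.proj (Fin.natAdd n j) :
      (Fin (n + n) → ℂ) →ₗ[ℂ] ℂ).smulRight
        (CliffordAlgebra.contractLeft (Q := (0 : QuadraticForm ℂ (Fin n → ℂ))) (LinearMap.proj j)) +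
    (-LinearMap.proj (Fin.castAdd n j) + Complex.I • LinearMap.proj (Fin.natAdd n j) :
      (Fin (n + n) → ℂ) →ₗ[ℂ] ℂ).smulRight
        (LinearMap.mulLeft ℂ (ExteriorAlgebra.ι ℂ (Pi.single j (1 : ℂ)))))

lemma spinAct_apply (n : ℕ) (v : Fin (n + n) → ℂ) (x : ExteriorAlgebra ℂ (Fin n → ℂ)) :
    spinAct n v x = CliffordAlgebra.contractLeft (Q := (0 : QuadraticForm ℂ (Fin n → ℂ)))
        (∑ j, (v (Fin.castAdd n j) + Complex.I * v (Fin.natAdd n j)) • LinearMap.proj j) x +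
      ExteriorAlgebra.ι ℂ
        (fun j => -v (Fin.castAdd n j) + Complex.I * v (Fin.natAdd n j)) * x := by
  have h : (fun j => -v (Fin.castAdd n j) + Complex.I * v (Fin.natAdd n j)) =
      ∑ j, (-v (Fin.castAdd n j) + Complex.I * v (Fin.natAdd n j)) • Pi.single j (1 : ℂ) := by
    rw [← pi_eq_sum_univ']
  rw [h]
  simp only [spinAct, LinearMap.sum_apply, LinearMap.add_apply, LinearMap.smulRight_apply,
    LinearMap.smul_apply, LinearMap.neg_apply, LinearMap.proj_apply, map_sum, map_smul,
    smul_eq_mul, Finset.sum_add_distrib, Finset.sum_mul, LinearMap.mulLeft_apply, smul_mul_assoc]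

lemma spinAct_mul_self (n : ℕ) (v : Fin (n + n) → ℂ) :
    spinAct n v * spinAct n v = algebraMap ℂ _ (negQ ℂ (n + n) v) := by
  refine LinearMap.ext fun x => ?_
  rw [Module.End.mul_apply, spinAct_apply, spinAct_apply, map_add,
    CliffordAlgebra.contractLeft_contractLeft, zero_add, mul_add, ExteriorAlgebra.ι,
    CliffordAlgebra.contractLeft_ι_mul, ← mul_assoc, CliffordAlgebra.ι_sq_scalar]
  simp only [zero_apply, map_zero, zero_mul, add_zero, sub_add_cancel,
    Module.algebraMap_end_apply]
  congr 1
  simp only [LinearMap.sum_apply, LinearMap.smul_apply, LinearMap.proj_apply, smul_eq_mul, negQ,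
    QuadraticMap.weightedSumSquares_apply]
  rw [Fin.sum_univ_add, ← Finset.sum_add_distrib]
  refine Finset.sum_congr rfl fun j _ => ?_
  linear_combination v (Fin.natAdd n j) ^ 2 * Complex.I_sq

/-- The spinor representation of `ℂ_{2n}` on the exterior algebra of `ℂⁿ`. -/
def spinRep (n : ℕ) : Cl n →ₐ[ℂ] Module.End ℂ (ExteriorAlgebra ℂ (Fin n → ℂ)) :=
  CliffordAlgebra.lift (negQ ℂ (n + n)) ⟨spinAct n, spinAct_mul_self n⟩

lemma Iel_ne_zero (n : ℕ) : Iel n ≠ 0 := by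
  have hd : ∀ (j : Fin n) x, spinRep n (ffd n j) x = ExteriorAlgebra.ι ℂ (Pi.single j 1) * x := by
    intro j x
    rw [ffd_eq, map_smul, spinRep, CliffordAlgebra.lift_ι_apply]
    have h1 : ∀ k, wittVec n Complex.I j (Fin.castAdd n k) +
        Complex.I * wittVec n Complex.I j (Fin.natAdd n k) = 0 := by
      intro k
      by_cases hk : k = j <;>
        simp [wittVec_castAdd, wittVec_natAdd, hk, -Fin.natAdd_eq_addNat]
    have h2 : (fun k => -wittVec n Complex.I j (Fin.castAdd n k) +
        Complex.I * wittVec n Complex.I j (Fin.natAdd n k)) =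
        (-2 : ℂ) • (Pi.single j 1 : Fin n → ℂ) := by
      funext k
      by_cases hk : k = j <;>
        simp [wittVec_castAdd, wittVec_natAdd, hk, -Fin.natAdd_eq_addNat]
      norm_num
    rw [LinearMap.smul_apply, spinAct_apply, h2]
    simp [h1, -Fin.natAdd_eq_addNat]
  have hf : ∀ (j : Fin n) x, spinRep n (ff n j) x = CliffordAlgebra.contractLeft
      (Q := (0 : QuadraticForm ℂ (Fin n → ℂ))) (LinearMap.proj j) x := by
    intro j x
    rw [ff_eq, map_smul, spinRep, CliffordAlgebra.lift_ι_apply]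
    have h1 : ∀ k, wittVec n (-Complex.I) j (Fin.castAdd n k) +
        Complex.I * wittVec n (-Complex.I) j (Fin.natAdd n k) = if k = j then 2 else 0 := by
      intro k
      by_cases hk : k = j <;>
        simp [wittVec_castAdd, wittVec_natAdd, hk, -Fin.natAdd_eq_addNat]
      norm_num
    have h2 : (fun k => -wittVec n (-Complex.I) j (Fin.castAdd n k) +
        Complex.I * wittVec n (-Complex.I) j (Fin.natAdd n k)) = 0 := by
      funext k
      by_cases hk : k = j <;>
        simp [wittVec_castAdd, wittVec_natAdd, hk, -Fin.natAdd_eq_addNat]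
    rw [LinearMap.smul_apply, spinAct_apply, h2]
    simp [h1, -Fin.natAdd_eq_addNat]
  have key : ∀ l : List (Fin n),
      spinRep n (l.map fun j => ff n j * ffd n j).prod (1 : ExteriorAlgebra ℂ (Fin n → ℂ)) = 1 := by
    intro l
    induction l with
    | nil => simp
    | cons j l ih =>
      rw [List.map_cons, List.prod_cons, map_mul, map_mul, Module.End.mul_apply, ih,
        Module.End.mul_apply, hd, hf, ExteriorAlgebra.ι, CliffordAlgebra.contractLeft_ι_mul,
        CliffordAlgebra.contractLeft_one]
      simp
  intro h0
  have := key (List.finRange n)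
  rw [← Iel, h0] at this
  simp at this

lemma blade_ne_zero (n : ℕ) (s : Finset (Fin n)) : blade n s ≠ 0 := by
  have key : ∀ l : List (Fin n), l.Nodup → bladeList n l ≠ 0 := by
    intro l
    induction l with
    | nil => simpa [bladeList] using Iel_ne_zero n
    | cons j l ih =>
      intro hl h0
      have hjl := (List.nodup_cons.1 hl).1
      have h1 := sum_ffd_ff_bladeList n (Pi.single j 1) l
      have h2 : (l.map (Pi.single j (1 : ℂ) : Fin n → ℂ)).sum = 0 := by
        refine List.sum_eq_zero fun x hx => ?_
        obtain ⟨k, hk, rfl⟩ := List.mem_map.1 hx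
        exact Pi.single_eq_of_ne (by rintro rfl; exact hjl hk) _
      rw [h2, Finset.sum_eq_single j (fun k _ hk => by simp [hk]) (by simp), Pi.single_eq_same,
        one_smul, zero_smul] at h1
      have h3 := ff_mul_ffd_mul n j j (bladeList n l)
      rw [← bladeList_cons, h0, h1] at h3
      exact ih (List.nodup_cons.1 hl).2 (by simpa using h3.symm)
  exact key _ (Finset.sort_nodup _ _)

lemma blade_linearIndependent (n : ℕ) : LinearIndependent ℂ (blade n) := by
  refine Module.End.eigenvectors_linearIndependent' (∑ j : Fin n, (2 : ℂ) ^ (j : ℕ) •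
    (LinearMap.mulLeft ℂ (ffd n j) ∘ₗ LinearMap.mulLeft ℂ (ff n j)))
    (fun s => ((∑ j ∈ s.map Fin.valEmbedding, 2 ^ j : ℕ) : ℂ)) ?_ _ fun s => ?_
  · intro s t hst
    exact Finset.map_injective _ (Finset.geomSum_injective le_rfl (Nat.cast_injective hst))
  · refine ⟨Module.End.mem_eigenspace_iff.2 ?_, blade_ne_zero n s⟩
    have h := sum_ffd_ff_bladeList n (fun j => (2 : ℂ) ^ (j : ℕ)) (s.sort (· ≤ ·))
    rw [← blade_eq_bladeList] at h
    have hs : ((s.sort (· ≤ ·)).map fun j : Fin n => (2 : ℂ) ^ (j : ℕ)).sum =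
        ((∑ j ∈ s.map Fin.valEmbedding, 2 ^ j : ℕ) : ℂ) := by
      rw [← List.sum_toFinset _ (Finset.sort_nodup s _), Finset.sort_toFinset]
      simp
    rw [← hs, ← h]
    simp [LinearMap.sum_apply]

section

open scoped TensorProduct

/-! ### Polynomials with Clifford coefficients and the Howe dual operators -/

/-- Polynomials in `z_j` (the variables `inl j`) and `z_j^c` (the variables `inr j`). -/
abbrev Pol (n : ℕ) : Type := MvPolynomial (Fin n ⊕ Fin n) ℂ

/-- Polynomials with coefficients in the Clifford algebra. -/
abbrev PolCl (n : ℕ) : Type := Pol n ⊗[ℂ] Cl n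

/-- The bidegrees of the variables. -/
def biWeight (n : ℕ) : Fin n ⊕ Fin n → ℕ × ℕ := Sum.elim (fun _ => (1, 0)) (fun _ => (0, 1))

/-- The polynomials of bidegree `(a, b)`. -/
def biPol (n a b : ℕ) : Submodule ℂ (Pol n) :=
  MvPolynomial.weightedHomogeneousSubmodule ℂ (biWeight n) (a, b)

/-- The polynomials of bidegree `(a, b)` with coefficients in `(∧_n†)^{(r)} I`. -/
def gr (n a b r : ℕ) : Submodule ℂ (PolCl n) :=
  Submodule.map₂ (TensorProduct.mk ℂ (Pol n) (Cl n)) (biPol n a b) (Lam n r)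

lemma weight_biWeight (n : ℕ) (d : Fin n ⊕ Fin n →₀ ℕ) :
    Finsupp.weight (biWeight n) d = (∑ j, d (Sum.inl j), ∑ j, d (Sum.inr j)) := by
  rw [Finsupp.weight_apply, Finsupp.sum_fintype _ _ (by simp), Fintype.sum_sum_type]
  ext <;> simp [biWeight, Prod.fst_sum, Prod.snd_sum]

lemma mem_biPol {n a b : ℕ} {F : Pol n} :
    F ∈ biPol n a b ↔ ∀ d, F.coeff d ≠ 0 →
      ∑ j, d (Sum.inl j) = a ∧ ∑ j, d (Sum.inr j) = b := by
  rw [biPol, MvPolynomial.mem_weightedHomogeneousSubmodule, MvPolynomial.IsWeightedHomogeneous]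
  simp only [weight_biWeight, Prod.mk.injEq]

lemma biPol_eq_span (n a b : ℕ) :
    biPol n a b = Submodule.span ℂ ((fun d => MvPolynomial.monomial d (1 : ℂ)) ''
      {d | ∑ j, d (Sum.inl j) = a ∧ ∑ j, d (Sum.inr j) = b}) := by
  apply le_antisymm
  · intro F hF
    rw [MvPolynomial.as_sum F]
    refine Submodule.sum_mem _ fun d hd => ?_
    rw [← mul_one (F.coeff d), ← smul_eq_mul, ← MvPolynomial.smul_monomial]
    exact Submodule.smul_mem _ _ (Submodule.subset_span
      ⟨d, mem_biPol.1 hF d (MvPolynomial.mem_support_iff.1 hd), rfl⟩)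
  · refine Submodule.span_le.2 ?_
    rintro _ ⟨d, hd, rfl⟩
    refine mem_biPol.2 fun d' hd' => ?_
    rw [MvPolynomial.coeff_monomial] at hd'
    obtain rfl : d = d' := by by_contra h; simp [h] at hd'
    exact hd

lemma pderiv_mem_biPol {n a b a' b' : ℕ} (i : Fin n ⊕ Fin n) {F : Pol n} (hF : F ∈ biPol n a b)
    (h : (a', b') + biWeight n i = (a, b)) : MvPolynomial.pderiv i F ∈ biPol n a' b' :=
  MvPolynomial.IsWeightedHomogeneous.pderiv hF h

lemma X_mul_mem_biPol {n a b a' b' : ℕ} (i : Fin n ⊕ Fin n) {F : Pol n} (hF : F ∈ biPol n a b)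
    (h : biWeight n i + (a, b) = (a', b')) : MvPolynomial.X i * F ∈ biPol n a' b' := by
  rw [biPol, ← h]
  exact (MvPolynomial.isWeightedHomogeneous_X ℂ (biWeight n) i).mul hF

lemma biPol_induction {n a b : ℕ} {M : Type*} [AddCommGroup M] [Module ℂ M] {f : Pol n →ₗ[ℂ] M}
    (h : ∀ d : Fin n ⊕ Fin n →₀ ℕ, ∑ j, d (Sum.inl j) = a → ∑ j, d (Sum.inr j) = b →
      f (MvPolynomial.monomial d 1) = 0) : ∀ F ∈ biPol n a b, f F = 0 := by
  suffices biPol n a b ≤ LinearMap.ker f from this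
  rw [biPol_eq_span, Submodule.span_le]
  rintro _ ⟨d, hd, rfl⟩
  exact h d hd.1 hd.2

lemma pderiv_inl_eq_zero {n b : ℕ} (j : Fin n) {F : Pol n} (hF : F ∈ biPol n 0 b) :
    MvPolynomial.pderiv (Sum.inl j) F = 0 := by
  refine biPol_induction (f := (MvPolynomial.pderiv (Sum.inl j)).toLinearMap)
    (fun d hd _ => ?_) F hF
  have : d (Sum.inl j) = 0 := Finset.sum_eq_zero_iff.1 hd j (Finset.mem_univ j)
  simp [MvPolynomial.pderiv_monomial, this]

lemma pderiv_inr_eq_zero {n a : ℕ} (j : Fin n) {F : Pol n} (hF : F ∈ biPol n a 0) :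
    MvPolynomial.pderiv (Sum.inr j) F = 0 := by
  refine biPol_induction (f := (MvPolynomial.pderiv (Sum.inr j)).toLinearMap)
    (fun d _ hd => ?_) F hF
  have : d (Sum.inr j) = 0 := Finset.sum_eq_zero_iff.1 hd j (Finset.mem_univ j)
  simp [MvPolynomial.pderiv_monomial, this]

/-- Partial differentiation as a linear map. -/
def del {n : ℕ} (i : Fin n ⊕ Fin n) : Module.End ℂ (Pol n) :=
  (MvPolynomial.pderiv i).toLinearMap

/-- Multiplication by a variable as a linear map. -/
def mulX {n : ℕ} (i : Fin n ⊕ Fin n) : Module.End ℂ (Pol n) :=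
  LinearMap.mulLeft ℂ (MvPolynomial.X i)

lemma del_apply {n : ℕ} (i : Fin n ⊕ Fin n) (F : Pol n) : del i F = MvPolynomial.pderiv i F := rfl

lemma mulX_apply {n : ℕ} (i : Fin n ⊕ Fin n) (F : Pol n) : mulX i F = MvPolynomial.X i * F := rfl

lemma del_mul_del {n : ℕ} (i i' : Fin n ⊕ Fin n) : del i * del i' = del i' * del i := by
  refine LinearMap.ext fun F => ?_
  simp only [Module.End.mul_apply, del_apply]
  induction F using MvPolynomial.induction_on' with
  | monomial d c =>
    by_cases h : i = i'
    · rw [h]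
    · simp only [MvPolynomial.pderiv_monomial, Finsupp.tsub_apply, Finsupp.single_apply, h,
        Ne.symm h, if_false, tsub_zero]
      rw [tsub_right_comm, mul_right_comm]
  | add F G hF hG => simp only [map_add, hF, hG]

lemma del_mul_mulX {n : ℕ} (i i' : Fin n ⊕ Fin n) :
    del i * mulX i' = mulX i' * del i + (if i = i' then 1 else 0 : ℂ) • 1 := by
  refine LinearMap.ext fun F => ?_
  simp only [Module.End.mul_apply, del_apply, mulX_apply, LinearMap.add_apply, Derivation.leibniz,
    smul_eq_mul, LinearMap.smul_apply, Module.End.one_apply]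
  by_cases h : i = i'
  · subst h; simp
  · simp [MvPolynomial.pderiv_X_of_ne (Ne.symm h), h]

lemma sum_mulX_del_inl {n a b : ℕ} {F : Pol n} (hF : F ∈ biPol n a b) :
    (∑ j : Fin n, mulX (Sum.inl j) * del (Sum.inl j)) F = (a : ℂ) • F := by
  have := biPol_induction (f := (∑ j : Fin n, mulX (Sum.inl j) * del (Sum.inl j)) -
    (a : ℂ) • LinearMap.id) (fun d hd _ => ?_) F hF
  · simpa [sub_eq_zero] using this
  · simp only [LinearMap.sub_apply, LinearMap.sum_apply, Module.End.mul_apply, mulX_apply,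
      del_apply, MvPolynomial.X_mul_pderiv_monomial, ← Finset.sum_smul, hd]
    simp [Nat.cast_smul_eq_nsmul]

lemma sum_mulX_del_inr {n a b : ℕ} {F : Pol n} (hF : F ∈ biPol n a b) :
    (∑ j : Fin n, mulX (Sum.inr j) * del (Sum.inr j)) F = (b : ℂ) • F := by
  have := biPol_induction (f := (∑ j : Fin n, mulX (Sum.inr j) * del (Sum.inr j)) -
    (b : ℂ) • LinearMap.id) (fun d _ hd => ?_) F hF
  · simpa [sub_eq_zero] using this
  · simp only [LinearMap.sub_apply, LinearMap.sum_apply, Module.End.mul_apply, mulX_apply,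
      del_apply, MvPolynomial.X_mul_pderiv_monomial, ← Finset.sum_smul, hd]
    simp [Nat.cast_smul_eq_nsmul]

lemma gr_induction {n a b r : ℕ} {M : Type*} [AddCommGroup M] [Module ℂ M]
    {f : PolCl n →ₗ[ℂ] M} {S : Submodule ℂ M}
    (h : ∀ F ∈ biPol n a b, ∀ x ∈ Lam n r, f (F ⊗ₜ[ℂ] x) ∈ S) : ∀ u ∈ gr n a b r, f u ∈ S := by
  suffices gr n a b r ≤ S.comap f from this
  exact Submodule.map₂_le.2 h

lemma gr_eq_zero {n a b r : ℕ} {M : Type*} [AddCommGroup M] [Module ℂ M]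
    {f : PolCl n →ₗ[ℂ] M} (h : ∀ F ∈ biPol n a b, ∀ x ∈ Lam n r, f (F ⊗ₜ[ℂ] x) = 0)
    {u : PolCl n} (hu : u ∈ gr n a b r) : f u = 0 :=
  (Submodule.mem_bot ℂ).1 (gr_induction h u hu)

lemma gr_eq_smul {n a b r : ℕ} {f : PolCl n →ₗ[ℂ] PolCl n} {c : ℂ}
    (h : ∀ F ∈ biPol n a b, ∀ x ∈ Lam n r, f (F ⊗ₜ[ℂ] x) = c • (F ⊗ₜ[ℂ] x))
    {u : PolCl n} (hu : u ∈ gr n a b r) : f u = c • u := by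
  have := gr_eq_zero (f := f - c • LinearMap.id) (fun F hF x hx => by simp [h F hF x hx]) hu
  simpa [sub_eq_zero] using this

/-- The operator `∑_j v_j T_j`. -/
def cliffOp {n : ℕ} (T : Fin n → Module.End ℂ (Pol n)) (v : Fin n → Cl n) :
    Module.End ℂ (PolCl n) :=
  ∑ j, TensorProduct.map (T j) (LinearMap.mulLeft ℂ (v j))

/-- The action of an operator on the polynomial factor. -/
def polOp {n : ℕ} (T : Module.End ℂ (Pol n)) : Module.End ℂ (PolCl n) :=
  TensorProduct.map T LinearMap.id

lemma cliffOp_tmul {n : ℕ} (T : Fin n → Module.End ℂ (Pol n)) (v : Fin n → Cl n) (F : Pol n)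
    (x : Cl n) : cliffOp T v (F ⊗ₜ[ℂ] x) = ∑ j, T j F ⊗ₜ[ℂ] (v j * x) := by
  simp [cliffOp, LinearMap.sum_apply]

lemma polOp_tmul {n : ℕ} (T : Module.End ℂ (Pol n)) (F : Pol n) (x : Cl n) :
    polOp T (F ⊗ₜ[ℂ] x) = T F ⊗ₜ[ℂ] x := rfl

lemma tmul_mem_gr {n a b r : ℕ} {F : Pol n} {x : Cl n} (hF : F ∈ biPol n a b) (hx : x ∈ Lam n r) :
    F ⊗ₜ[ℂ] x ∈ gr n a b r :=
  Submodule.apply_mem_map₂ (TensorProduct.mk ℂ (Pol n) (Cl n)) hF hx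

lemma cliffOp_mem {n a b r a' b' r' : ℕ} {T : Fin n → Module.End ℂ (Pol n)} {v : Fin n → Cl n}
    (hT : ∀ j, ∀ F ∈ biPol n a b, T j F ∈ biPol n a' b')
    (hv : ∀ j, ∀ x ∈ Lam n r, v j * x ∈ Lam n r') {u : PolCl n} (hu : u ∈ gr n a b r) :
    cliffOp T v u ∈ gr n a' b' r' := by
  refine gr_induction (fun F hF x hx => ?_) u hu
  rw [cliffOp_tmul]
  exact Submodule.sum_mem _ fun j _ => tmul_mem_gr (hT j F hF) (hv j x hx)

lemma cliffOp_anticomm {n : ℕ} {T S : Fin n → Module.End ℂ (Pol n)} {v w : Fin n → Cl n} {c c' : ℂ}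
    (hv : ∀ j k, v j * w k + w k * v j = (if j = k then c else 0) • (1 : Cl n))
    (hT : ∀ j k, T j * S k = S k * T j + (if j = k then c' else 0) • 1) (u : PolCl n) :
    cliffOp T v (cliffOp S w u) + cliffOp S w (cliffOp T v u) =
      c • polOp (∑ j, S j * T j) u +
        c' • TensorProduct.map LinearMap.id (LinearMap.mulLeft ℂ (∑ j, v j * w j)) u := by
  induction u using TensorProduct.induction_on with
  | zero => simp
  | add u u' h h' =>
    simp only [map_add, smul_add]
    rw [add_add_add_comm, h, h']
    abel
  | tmul F x =>
    have hTS : ∀ j k, T j (S k F) = S k (T j F) + (if j = k then c' else 0) • F := fun j k =>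
      LinearMap.congr_fun (hT j k) F
    have hvw : ∀ j k, v j * (w k * x) + w k * (v j * x) = (if j = k then c else 0) • x :=
      fun j k => by rw [← mul_assoc, ← mul_assoc, ← add_mul, hv, smul_mul_assoc, one_mul]
    simp only [cliffOp_tmul, map_sum, polOp_tmul, TensorProduct.map_tmul, LinearMap.id_apply,
      LinearMap.mulLeft_apply, LinearMap.sum_apply, Module.End.mul_apply, Finset.sum_mul,
      TensorProduct.sum_tmul, TensorProduct.tmul_sum, Finset.smul_sum, mul_assoc]
    rw [Finset.sum_comm (f := fun i j => T j (S i F) ⊗ₜ[ℂ] (v j * (w i * x))),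
      ← Finset.sum_add_distrib, ← Finset.sum_add_distrib]
    refine Finset.sum_congr rfl fun j _ => ?_
    rw [← Finset.sum_add_distrib]
    have h : ∀ k, T j (S k F) ⊗ₜ[ℂ] (v j * (w k * x)) + S k (T j F) ⊗ₜ[ℂ] (w k * (v j * x)) =
        if j = k then c • (S k (T j F) ⊗ₜ[ℂ] x) + c' • (F ⊗ₜ[ℂ] (v j * (w k * x))) else 0 := by
      intro k
      rw [hTS, TensorProduct.add_tmul, add_right_comm, ← TensorProduct.tmul_add, hvw]
      split_ifs <;> simp [TensorProduct.smul_tmul']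
    rw [Finset.sum_congr rfl fun k _ => h k, Finset.sum_ite_eq]
    simp

/-- The operator `∂_z = ∑_j 𝔣_j† ∂_{z_j}`. -/
def opD (n : ℕ) : Module.End ℂ (PolCl n) := cliffOp (fun j => del (Sum.inl j)) (ffd n)

/-- The operator `∂_z† = ∑_j 𝔣_j ∂_{z_j^c}`. -/
def opDd (n : ℕ) : Module.End ℂ (PolCl n) := cliffOp (fun j => del (Sum.inr j)) (ff n)

/-- The operator `z = ∑_j 𝔣_j z_j`. -/
def opX (n : ℕ) : Module.End ℂ (PolCl n) := cliffOp (fun j => mulX (Sum.inl j)) (ff n)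

/-- The operator `z† = ∑_j 𝔣_j† z_j^c`. -/
def opXd (n : ℕ) : Module.End ℂ (PolCl n) := cliffOp (fun j => mulX (Sum.inr j)) (ffd n)

/-- The Laplace operator `∑_j ∂_{z_j} ∂_{z_j^c}`. -/
def lap (n : ℕ) : Module.End ℂ (PolCl n) :=
  polOp (∑ j : Fin n, del (Sum.inr j) * del (Sum.inl j))

/-- Multiplication by `|z|² = ∑_j z_j z_j^c`. -/
def normSqOp (n : ℕ) : Module.End ℂ (PolCl n) :=
  polOp (∑ j : Fin n, mulX (Sum.inr j) * mulX (Sum.inl j))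

section operators

variable {n a b r : ℕ} {u : PolCl n}

lemma opD_mem (hu : u ∈ gr n (a + 1) b r) : opD n u ∈ gr n a b (r + 1) :=
  cliffOp_mem (fun _ _ hF => pderiv_mem_biPol _ hF (by simp [biWeight]))
    (fun j _ hx => ffd_mul_mem_Lam j hx) hu

lemma opD_eq_zero (hu : u ∈ gr n 0 b r) : opD n u = 0 :=
  gr_eq_zero (fun F hF x _ => by
    simp [opD, cliffOp_tmul, del_apply, pderiv_inl_eq_zero _ hF]) hu

lemma opDd_mem (hu : u ∈ gr n a (b + 1) (r + 1)) : opDd n u ∈ gr n a b r :=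
  cliffOp_mem (fun _ _ hF => pderiv_mem_biPol _ hF (by simp [biWeight]))
    (fun j _ hx => ff_mul_mem_Lam j hx) hu

lemma opDd_eq_zero (hu : u ∈ gr n a 0 r) : opDd n u = 0 :=
  gr_eq_zero (fun F hF x _ => by
    simp [opDd, cliffOp_tmul, del_apply, pderiv_inr_eq_zero _ hF]) hu

lemma opX_mem (hu : u ∈ gr n a b (r + 1)) : opX n u ∈ gr n (a + 1) b r :=
  cliffOp_mem (fun _ _ hF => X_mul_mem_biPol _ hF (by simp [biWeight, add_comm]))
    (fun j _ hx => ff_mul_mem_Lam j hx) hu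

lemma opXd_mem (hu : u ∈ gr n a b r) : opXd n u ∈ gr n a (b + 1) (r + 1) :=
  cliffOp_mem (fun _ _ hF => X_mul_mem_biPol _ hF (by simp [biWeight, add_comm]))
    (fun j _ hx => ffd_mul_mem_Lam j hx) hu

lemma lap_mem (hu : u ∈ gr n (a + 1) (b + 1) r) : lap n u ∈ gr n a b r := by
  refine gr_induction (fun F hF x hx => ?_) u hu
  rw [lap, polOp_tmul, LinearMap.sum_apply]
  refine tmul_mem_gr (Submodule.sum_mem _ fun j _ => ?_) hx
  exact pderiv_mem_biPol (a := a) (b := b + 1) _ (pderiv_mem_biPol (b' := b + 1) _ hF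
    (by simp [biWeight])) (by simp [biWeight])

lemma lap_eq_zero_left (hu : u ∈ gr n 0 b r) : lap n u = 0 :=
  gr_eq_zero (fun F hF x _ => by
    simp [lap, polOp_tmul, del_apply, pderiv_inl_eq_zero _ hF]) hu

lemma lap_eq_zero_right (hu : u ∈ gr n a 0 r) : lap n u = 0 :=
  gr_eq_zero (fun F hF x _ => by
    simp only [lap, del_mul_del, polOp_tmul]
    simp [del_apply, pderiv_inr_eq_zero _ hF]) hu

lemma normSqOp_mem (hu : u ∈ gr n a b r) : normSqOp n u ∈ gr n (a + 1) (b + 1) r := by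
  refine gr_induction (fun F hF x hx => ?_) u hu
  rw [normSqOp, polOp_tmul, LinearMap.sum_apply]
  refine tmul_mem_gr (Submodule.sum_mem _ fun j _ => ?_) hx
  exact X_mul_mem_biPol (a := a + 1) (b := b) _ (X_mul_mem_biPol (b' := b) _ hF
    (by simp [biWeight, add_comm])) (by simp [biWeight, add_comm])

lemma opD_opD (u : PolCl n) : opD n (opD n u) = 0 := by
  have h := cliffOp_anticomm (c := 0) (c' := 0) (v := ffd n) (w := ffd n)
    (T := fun j => del (Sum.inl j)) (S := fun j => del (Sum.inl j))
    (by simp [ffd_mul_ffd]) (by simp [del_mul_del]) u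
  rw [zero_smul, zero_smul, add_zero, ← two_smul ℂ, smul_eq_zero_iff_right two_ne_zero] at h
  exact h

lemma opDd_opDd (u : PolCl n) : opDd n (opDd n u) = 0 := by
  have h := cliffOp_anticomm (c := 0) (c' := 0) (v := ff n) (w := ff n)
    (T := fun j => del (Sum.inr j)) (S := fun j => del (Sum.inr j))
    (by simp [ff_mul_ff]) (by simp [del_mul_del]) u
  rw [zero_smul, zero_smul, add_zero, ← two_smul ℂ, smul_eq_zero_iff_right two_ne_zero] at h
  exact h

lemma ffd_mul_ff (n : ℕ) (j k : Fin n) :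
    ffd n j * ff n k + ff n k * ffd n j = (if j = k then 1 else 0 : ℂ) • (1 : Cl n) := by
  rw [add_comm, ff_mul_ffd]
  simp only [eq_comm]

lemma opD_opDd (u : PolCl n) : opD n (opDd n u) + opDd n (opD n u) = lap n u := by
  have h := cliffOp_anticomm (c := 1) (c' := 0) (T := fun j => del (Sum.inl j))
    (S := fun j => del (Sum.inr j)) (ffd_mul_ff n)
    (fun j k => by simpa using del_mul_del _ _) u
  rwa [one_smul, zero_smul, add_zero] at h

lemma opDd_opX (u : PolCl n) : opDd n (opX n u) + opX n (opDd n u) = 0 := by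
  have h := cliffOp_anticomm (c := 0) (c' := 0) (v := ff n) (w := ff n)
    (T := fun j => del (Sum.inr j)) (S := fun j => mulX (Sum.inl j))
    (by simp [ff_mul_ff]) (by simp [del_mul_mulX]) u
  rwa [zero_smul, zero_smul, add_zero] at h

lemma polOp_eq_smul {T : Module.End ℂ (Pol n)} {c : ℂ} (hT : ∀ F ∈ biPol n a b, T F = c • F)
    (hu : u ∈ gr n a b r) : polOp T u = c • u :=
  gr_eq_smul (fun F hF x _ => by rw [polOp_tmul, hT F hF, TensorProduct.smul_tmul']) hu

lemma opD_opX (hu : u ∈ gr n a b r) : opD n (opX n u) + opX n (opD n u) = ((a : ℂ) + r) • u := by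
  have h := cliffOp_anticomm (c := 1) (c' := 1) (T := fun j => del (Sum.inl j))
    (S := fun j => mulX (Sum.inl j)) (ffd_mul_ff n)
    (fun j k => by simp [del_mul_mulX]) u
  rw [one_smul, one_smul, polOp_eq_smul (fun F => sum_mulX_del_inl) hu] at h
  have hN := gr_eq_smul (f := TensorProduct.map LinearMap.id
    (LinearMap.mulLeft ℂ (∑ j, ffd n j * ff n j))) (c := (r : ℂ))
    (fun F _ x hx => by simp [Finset.sum_mul, mul_assoc, sum_ffd_ff_mul hx]) hu
  rwa [hN, ← add_smul] at h

lemma opDd_opXd (hu : u ∈ gr n a b r) :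
    opDd n (opXd n u) + opXd n (opDd n u) = ((b : ℂ) + n - r) • u := by
  have h := cliffOp_anticomm (c := 1) (c' := 1) (T := fun j => del (Sum.inr j))
    (S := fun j => mulX (Sum.inr j)) (ff_mul_ffd n)
    (fun j k => by simp [del_mul_mulX]) u
  rw [one_smul, one_smul, polOp_eq_smul (fun F => sum_mulX_del_inr) hu] at h
  have hN := gr_eq_smul (f := TensorProduct.map LinearMap.id
    (LinearMap.mulLeft ℂ (∑ j, ff n j * ffd n j))) (c := (n : ℂ) - r)
    (fun F _ x hx => by
      have hs : ∑ j, ff n j * (ffd n j * x) = ((n : ℂ) - r) • x := by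
        rw [Finset.sum_congr rfl fun j _ => ff_mul_ffd_mul n j j x, Finset.sum_sub_distrib,
          sum_ffd_ff_mul hx, sub_smul]
        simp [Nat.cast_smul_eq_nsmul]
      simp [Finset.sum_mul, mul_assoc, hs]) hu
  rwa [hN, ← add_smul, ← add_sub_assoc] at h

lemma lap_normSqOp (hu : u ∈ gr n a b r) :
    lap n (normSqOp n u) = normSqOp n (lap n u) + ((a : ℂ) + b + n) • u := by
  have key : (∑ j : Fin n, del (Sum.inr j) * del (Sum.inl j)) *
      (∑ j : Fin n, mulX (Sum.inr j) * mulX (Sum.inl j)) =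
      (∑ j : Fin n, mulX (Sum.inr j) * mulX (Sum.inl j)) *
        (∑ j : Fin n, del (Sum.inr j) * del (Sum.inl j)) +
      ((∑ j : Fin n, mulX (Sum.inl j) * del (Sum.inl j)) +
        (∑ j : Fin n, mulX (Sum.inr j) * del (Sum.inr j)) + (n : ℂ) • 1) := by
    rw [Finset.sum_mul_sum, Finset.sum_mul_sum, Finset.sum_comm (f := fun i j =>
      mulX (Sum.inr i) * mulX (Sum.inl i) * (del (Sum.inr j) * del (Sum.inl j)))]
    have h : ∀ j k : Fin n, (del (Sum.inr j) * del (Sum.inl j)) *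
        (mulX (Sum.inr k) * mulX (Sum.inl k)) =
        (mulX (Sum.inr k) * mulX (Sum.inl k)) * (del (Sum.inr j) * del (Sum.inl j)) +
        if j = k then mulX (Sum.inl j) * del (Sum.inl j) + mulX (Sum.inr j) * del (Sum.inr j) + 1
        else 0 := by
      intro j k
      have h1 : del (Sum.inl j) * mulX (Sum.inr k) = mulX (Sum.inr k) * del (Sum.inl j) := by
        simp [del_mul_mulX]
      have h2 : del (Sum.inr j) * mulX (Sum.inl k) = mulX (Sum.inl k) * del (Sum.inr j) := by
        simp [del_mul_mulX]
      have h3 := del_mul_mulX (Sum.inl j) (Sum.inl k)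
      have h4 := del_mul_mulX (Sum.inr j) (Sum.inr k)
      rw [mul_assoc, ← mul_assoc (del (Sum.inl j)), h1, mul_assoc, h3, ← mul_assoc, h4]
      by_cases hjk : j = k
      · subst hjk
        simp only [if_true, one_smul, mul_add, add_mul, one_mul, mul_one, mul_assoc]
        rw [← mul_assoc (del (Sum.inr j)) (mulX (Sum.inl j)), h2, mul_assoc]
        abel
      · simp only [Sum.inl.injEq, Sum.inr.injEq, hjk, if_false, zero_smul, add_zero, mul_assoc]
        rw [← mul_assoc (del (Sum.inr j)) (mulX (Sum.inl k)), h2, mul_assoc]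
    simp only [h, Finset.sum_add_distrib, Finset.sum_ite_eq, Finset.mem_univ, if_true,
      Finset.sum_const, Finset.card_univ, Fintype.card_fin, Nat.cast_smul_eq_nsmul]
  have hE := gr_eq_smul (f := lap n * normSqOp n - normSqOp n * lap n) (c := (a : ℂ) + b + n)
    (fun F hF x _ => ?_) hu
  · rw [LinearMap.sub_apply, sub_eq_iff_eq_add'] at hE
    exact hE
  · have := LinearMap.congr_fun key F
    simp only [Module.End.mul_apply, LinearMap.add_apply, sum_mulX_del_inl hF,
      sum_mulX_del_inr hF, LinearMap.smul_apply, Module.End.one_apply] at this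
    simp only [LinearMap.sub_apply, Module.End.mul_apply, lap, normSqOp, polOp_tmul, this,
      TensorProduct.add_tmul, TensorProduct.smul_tmul', add_smul]
    abel

lemma lap_iterate_normSqOp (k : ℕ) (hu : u ∈ gr n a b r) :
    (lap n ^ (k + 1)) (normSqOp n u) = normSqOp n ((lap n ^ (k + 1)) u) +
      (((k : ℂ) + 1) * (a + b + n - k)) • (lap n ^ k) u := by
  induction k generalizing a b u with
  | zero => simpa using lap_normSqOp hu
  | succ k ih =>
    have step : (lap n ^ (k + 1 + 1)) (normSqOp n u) =
        (lap n ^ (k + 1)) (normSqOp n (lap n u)) +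
          ((a : ℂ) + b + n) • (lap n ^ (k + 1)) u := by
      rw [pow_succ, Module.End.mul_apply, lap_normSqOp hu, map_add, map_smul]
    have hzero : lap n u = 0 → (lap n ^ (k + 1 + 1)) (normSqOp n u) =
        normSqOp n ((lap n ^ (k + 1 + 1)) u) +
          ((((k + 1 : ℕ) : ℂ) + 1) * (a + b + n - (k + 1 : ℕ))) • (lap n ^ (k + 1)) u := by
      intro h0
      have h1 : ∀ m, (lap n ^ (m + 1)) u = 0 := fun m => by
        rw [pow_succ, Module.End.mul_apply, h0, map_zero]
      rw [step, h0, h1, h1]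
      simp
    obtain _ | a := a
    · exact hzero (lap_eq_zero_left hu)
    obtain _ | b := b
    · exact hzero (lap_eq_zero_right hu)
    have hp : ∀ m, (lap n ^ m) (lap n u) = (lap n ^ (m + 1)) u := fun m => by
      rw [pow_succ, Module.End.mul_apply]
    rw [step, ih (lap_mem hu), hp, hp, add_assoc, ← add_smul]
    congr 2
    push_cast
    ring

lemma lap_pow_eq_zero (hu : u ∈ gr n a b r) : (lap n ^ (a + 1)) u = 0 := by
  induction a generalizing b u with
  | zero => simpa using lap_eq_zero_left hu
  | succ a ih =>
    rw [pow_succ, Module.End.mul_apply]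
    obtain _ | b := b
    · rw [lap_eq_zero_right hu, map_zero]
    · exact ih (lap_mem hu)

lemma exists_lap_eq (hn : 0 < n) (hu : u ∈ gr n a b r) :
    ∃ w ∈ gr n (a + 1) (b + 1) r, lap n w = u := by
  suffices H : ∀ k ≤ a + 1, ∀ u ∈ gr n a b r, (lap n ^ k) u = 0 →
      ∃ w ∈ gr n (a + 1) (b + 1) r, lap n w = u from
    H (a + 1) le_rfl u hu (lap_pow_eq_zero hu)
  intro k
  induction k with
  | zero => exact fun _ u _ h => ⟨0, zero_mem _, by simpa using h.symm⟩
  | succ k ih =>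
    intro hk u hu h
    set μ : ℂ := ((k : ℂ) + 1) * (a + b + n - k) with hμ
    have hμ0 : μ ≠ 0 := by
      have : μ = (((k + 1) * (a - k + b + n) : ℕ) : ℂ) := by
        rw [hμ]
        push_cast [Nat.cast_sub (show k ≤ a by omega)]
        ring
      rw [this]
      exact Nat.cast_ne_zero.2 (Nat.mul_ne_zero (by omega) (by omega))
    have hlap := lap_mem (normSqOp_mem hu)
    obtain ⟨w, hw, hw'⟩ := ih (by omega) (lap n (normSqOp n u) - μ • u)
      (sub_mem hlap (Submodule.smul_mem _ _ hu)) (by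
        rw [map_sub, map_smul, ← Module.End.mul_apply, ← pow_succ, lap_iterate_normSqOp k hu, h,
          map_zero, zero_add, sub_self])
    refine ⟨μ⁻¹ • (normSqOp n u - w),
      Submodule.smul_mem _ _ (sub_mem (normSqOp_mem hu) hw), ?_⟩
    rw [map_smul, map_sub, hw', sub_sub_cancel, smul_smul, inv_mul_cancel₀ hμ0, one_smul]

end operators

/-! ### Dimensions -/

/-- The kernel of `∂_z†` in the given multidegree. -/
def grDd (n a b r : ℕ) : Submodule ℂ (PolCl n) := gr n a b r ⊓ LinearMap.ker (opDd n)

/-- The harmonic elements of the kernel of `∂_z†` in the given multidegree. -/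
def grDdLap (n a b r : ℕ) : Submodule ℂ (PolCl n) := grDd n a b r ⊓ LinearMap.ker (lap n)

/-- The Hermitean monogenic elements in the given multidegree. -/
def grHM (n a b r : ℕ) : Submodule ℂ (PolCl n) := grDd n a b r ⊓ LinearMap.ker (opD n)

/-- The monomials with blade coefficients in the given multidegree. -/
def grBasis (n a b r : ℕ) (i : Finset.finsuppAntidiag (Finset.univ : Finset (Fin n)) a ×
    Finset.finsuppAntidiag (Finset.univ : Finset (Fin n)) b ×
    Finset.powersetCard r (Finset.univ : Finset (Fin n))) : PolCl n :=
  MvPolynomial.monomial (Finsupp.sumElim i.1.1 i.2.1.1) 1 ⊗ₜ[ℂ] blade n i.2.2.1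

lemma grBasis_linearIndependent (n a b r : ℕ) : LinearIndependent ℂ (grBasis n a b r) := by
  have h := LinearIndependent.tmul_of_isDomain (MvPolynomial.basisMonomials
    (Fin n ⊕ Fin n) ℂ).linearIndependent (blade_linearIndependent n)
  refine h.comp (fun i : Finset.finsuppAntidiag (Finset.univ : Finset (Fin n)) a ×
    Finset.finsuppAntidiag (Finset.univ : Finset (Fin n)) b ×
    Finset.powersetCard r (Finset.univ : Finset (Fin n)) =>
      (Finsupp.sumElim i.1.1 i.2.1.1, i.2.2.1)) ?_
  rintro ⟨α, β, s⟩ ⟨α', β', s'⟩ hi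
  obtain ⟨h1, h2⟩ := Prod.ext_iff.1 hi
  have h3 := fun j => DFunLike.congr_fun h1 (Sum.inl j)
  have h4 := fun j => DFunLike.congr_fun h1 (Sum.inr j)
  simp only [Finsupp.sumElim_inl, Finsupp.sumElim_inr] at h3 h4
  simp only [Prod.mk.injEq]
  exact ⟨Subtype.ext (Finsupp.ext h3), Subtype.ext (Finsupp.ext h4), Subtype.ext h2⟩

lemma gr_eq_span (n a b r : ℕ) : gr n a b r = Submodule.span ℂ (Set.range (grBasis n a b r)) := by
  rw [gr, biPol_eq_span, Lam, Submodule.map₂_span_span]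
  congr 1
  ext u
  constructor
  · rintro ⟨_, ⟨d, ⟨hd, hd'⟩, rfl⟩, _, ⟨s, hs, rfl⟩, rfl⟩
    refine ⟨⟨⟨Finsupp.comapDomain Sum.inl d Sum.inl_injective.injOn, ?_⟩,
      ⟨Finsupp.comapDomain Sum.inr d Sum.inr_injective.injOn, ?_⟩, ⟨s, ?_⟩⟩, ?_⟩
    · exact Finset.mem_finsuppAntidiag.2 ⟨hd, Finset.subset_univ _⟩
    · exact Finset.mem_finsuppAntidiag.2 ⟨hd', Finset.subset_univ _⟩
    · simpa [Finset.mem_powersetCard] using hs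
    · have : Finsupp.sumElim (Finsupp.comapDomain Sum.inl d Sum.inl_injective.injOn)
          (Finsupp.comapDomain Sum.inr d Sum.inr_injective.injOn) = d := by
        ext (j | j) <;> simp
      simp only [grBasis, this, TensorProduct.mk_apply]
  · rintro ⟨⟨⟨α, hα⟩, ⟨β, hβ⟩, ⟨s, hs⟩⟩, rfl⟩
    refine ⟨_, ⟨Finsupp.sumElim α β, ⟨?_, ?_⟩, rfl⟩, _, ⟨s, ?_, rfl⟩, rfl⟩
    · simpa [Finset.mem_finsuppAntidiag] using hα
    · simpa [Finset.mem_finsuppAntidiag] using hβ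
    · simpa [Finset.mem_powersetCard] using hs

instance (n a b r : ℕ) : FiniteDimensional ℂ (gr n a b r) := by
  rw [gr_eq_span]
  exact FiniteDimensional.span_of_finite ℂ (Set.finite_range _)

lemma finrank_inf_ker_add {V W : Type*} [AddCommGroup V] [Module ℂ V] [AddCommGroup W] [Module ℂ W]
    (f : V →ₗ[ℂ] W) {S : Submodule ℂ V} {T : Submodule ℂ W} [FiniteDimensional ℂ S]
    (h : S.map f = T) :
    Module.finrank ℂ ↥(S ⊓ LinearMap.ker f) + Module.finrank ℂ T = Module.finrank ℂ S := by
  rw [← LinearMap.finrank_range_add_finrank_ker (f.domRestrict S), add_comm,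
    LinearMap.range_domRestrict, h, LinearMap.ker_domRestrict, ← Submodule.map_comap_subtype]
  congr 1
  exact (Submodule.equivSubtypeMap S _).finrank_eq.symm

lemma finrank_gr (n a b r : ℕ) : Module.finrank ℂ (gr n a b r) =
    (n + a - 1).choose a * (n + b - 1).choose b * n.choose r := by
  rw [gr_eq_span, finrank_span_eq_card (grBasis_linearIndependent n a b r)]
  simp [Finset.card_finsuppAntidiag_nat_eq_choose, mul_assoc]

instance (n a b r : ℕ) : FiniteDimensional ℂ (grDd n a b r) :=
  Submodule.finiteDimensional_of_le (inf_le_left : grDd n a b r ≤ gr n a b r)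

instance (n a b r : ℕ) : FiniteDimensional ℂ (grDdLap n a b r) :=
  Submodule.finiteDimensional_of_le (inf_le_left : grDdLap n a b r ≤ grDd n a b r)

instance (n a b r : ℕ) : FiniteDimensional ℂ (grHM n a b r) :=
  Submodule.finiteDimensional_of_le (inf_le_left : grHM n a b r ≤ grDd n a b r)

lemma gr_succ_eq_bot (n a b : ℕ) : gr n a b (n + 1) = ⊥ := by
  rw [← Submodule.finrank_eq_zero (R := ℂ), finrank_gr, Nat.choose_succ_self, mul_zero]

lemma grDd_right_zero (n a r : ℕ) : grDd n a 0 r = gr n a 0 r :=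
  inf_eq_left.2 fun _ hu => opDd_eq_zero hu

lemma grDd_degree_zero (n a b : ℕ) : grDd n a b 0 = gr n a b 0 :=
  inf_eq_left.2 fun _ hu => gr_eq_zero (f := opDd n)
    (fun F _ x hx => by simp [opDd, cliffOp_tmul, ff_mul_eq_zero _ hx]) hu

lemma grDdLap_right_zero (n a r : ℕ) : grDdLap n a 0 r = grDd n a 0 r :=
  inf_eq_left.2 fun _ hu => lap_eq_zero_right hu.1

lemma grHM_left_zero (n b r : ℕ) : grHM n 0 b r = grDd n 0 b r :=
  inf_eq_left.2 fun _ hu => opD_eq_zero hu.1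

lemma grHM_top (n a b : ℕ) : grHM n a b n = grDd n a b n := by
  obtain _ | a := a
  · exact grHM_left_zero n b n
  · refine inf_eq_left.2 fun u hu => ?_
    have h := opD_mem hu.1
    rwa [gr_succ_eq_bot] at h

lemma grHM_eq_inf (n a b r : ℕ) : grHM n a b r = grDdLap n a b r ⊓ LinearMap.ker (opD n) := by
  refine le_antisymm (fun u hu => ⟨⟨hu.1, ?_⟩, hu.2⟩) (inf_le_inf_right _ inf_le_left)
  refine LinearMap.mem_ker.2 ?_
  rw [← opD_opDd, LinearMap.mem_ker.1 hu.1.2, LinearMap.mem_ker.1 hu.2,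
    map_zero, map_zero, add_zero]

lemma map_opDd_gr {n r : ℕ} (a b : ℕ) (hr : r < n) :
    (gr n a (b + 1) (r + 1)).map (opDd n) = grDd n a b r := by
  refine le_antisymm (Submodule.map_le_iff_le_comap.2 fun u hu => ⟨opDd_mem hu, opDd_opDd u⟩) ?_
  intro v hv
  have hc : (b : ℂ) + n - r ≠ 0 := by
    rw [add_sub_assoc, ← Nat.cast_sub hr.le, ← Nat.cast_add]
    exact Nat.cast_ne_zero.2 (by omega)
  have h := opDd_opXd hv.1
  rw [LinearMap.mem_ker.1 hv.2, map_zero, add_zero] at h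
  refine ⟨((b : ℂ) + n - r)⁻¹ • opXd n v, Submodule.smul_mem _ _ (opXd_mem hv.1), ?_⟩
  rw [map_smul, h, smul_smul, inv_mul_cancel₀ hc, one_smul]

lemma opDd_lap {n : ℕ} (u : PolCl n) : opDd n (lap n u) = lap n (opDd n u) := by
  rw [← opD_opDd, ← opD_opDd, map_add, opDd_opDd, opDd_opDd, map_zero, add_zero, zero_add]

lemma map_lap_grDd {n r : ℕ} (a b : ℕ) (hr : r < n) :
    (grDd n (a + 1) (b + 1) r).map (lap n) = grDd n a b r := by
  refine le_antisymm (Submodule.map_le_iff_le_comap.2 fun u hu => ⟨lap_mem hu.1, ?_⟩) ?_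
  · exact LinearMap.mem_ker.2 (by rw [opDd_lap, LinearMap.mem_ker.1 hu.2, map_zero])
  · rw [← map_opDd_gr a b hr]
    rintro _ ⟨u, hu, rfl⟩
    obtain ⟨w, hw, rfl⟩ := exists_lap_eq (by omega) hu
    exact ⟨opDd n w, ⟨opDd_mem hw, opDd_opDd w⟩, (opDd_lap w).symm⟩

lemma map_opD_grDdLap (n a b r : ℕ) :
    (grDdLap n (a + 1) b r).map (opD n) = grHM n a b (r + 1) := by
  refine le_antisymm (Submodule.map_le_iff_le_comap.2 fun u hu =>
    ⟨⟨opD_mem hu.1.1, ?_⟩, opD_opD u⟩) ?_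
  · have h := opD_opDd u
    rwa [LinearMap.mem_ker.1 hu.1.2, LinearMap.mem_ker.1 hu.2, map_zero, zero_add] at h
  · intro v hv
    have hc : (a : ℂ) + (r + 1 : ℕ) ≠ 0 := by
      rw [← Nat.cast_add]
      exact Nat.cast_ne_zero.2 (by omega)
    have h := opD_opX hv.1.1
    rw [LinearMap.mem_ker.1 hv.2, map_zero, add_zero] at h
    have h' := opDd_opX v
    rw [LinearMap.mem_ker.1 hv.1.2, map_zero, add_zero] at h'
    refine ⟨((a : ℂ) + (r + 1 : ℕ))⁻¹ • opX n v,
      Submodule.smul_mem _ _ ⟨⟨opX_mem hv.1.1, h'⟩, ?_⟩, ?_⟩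
    · refine LinearMap.mem_ker.2 ?_
      rw [← opD_opDd, h', h, map_zero, map_smul, LinearMap.mem_ker.1 hv.1.2, smul_zero, add_zero]
    · rw [map_smul, h, smul_smul, inv_mul_cancel₀ hc, one_smul]

lemma choose_succ_cast (N m : ℕ) : ((N + (m + 1)).choose (m + 1) : ℚ) * (m + 1) =
    (N + m).choose m * (m + N + 1) := by
  have h := Nat.add_one_mul_choose_eq (N + m) m
  rw [← add_assoc]
  have h' : ((N + m + 1 : ℕ) : ℚ) * (N + m).choose m =
    (N + m + 1).choose (m + 1) * (m + 1 : ℕ) := by exact_mod_cast h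
  push_cast at h'
  linear_combination -h'

lemma choose_succ_right_cast {N r : ℕ} (hr : r ≤ N) :
    (N.choose (r + 1) : ℚ) * (r + 1) = N.choose r * (N - r) := by
  have h := Nat.choose_succ_right_eq N r
  have h' : (N.choose (r + 1) : ℚ) * (r + 1 : ℕ) = N.choose r * (N - r : ℕ) := by exact_mod_cast h
  rwa [Nat.cast_sub hr, Nat.cast_add, Nat.cast_one] at h'

lemma finrank_gr_cast (N a b r : ℕ) : (Module.finrank ℂ (gr (N + 1) a b r) : ℚ) =
    (N + a).choose a * (N + b).choose b * (N + 1).choose r := by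
  rw [finrank_gr, Nat.succ_add_sub_one, Nat.succ_add_sub_one]
  push_cast
  ring

lemma finrank_grDd {N r : ℕ} (a b : ℕ) (hr : r ≤ N + 1) :
    ((b : ℚ) + N + 1 - r) * Module.finrank ℂ (grDd (N + 1) a b r) =
      (N + a).choose a * (N + b).choose b * (b + N + 1) * N.choose r := by
  induction r generalizing b with
  | zero =>
    rw [grDd_degree_zero, finrank_gr_cast]
    simp
    ring
  | succ r ih =>
    have hC := choose_succ_right_cast (N := N) (r := r) (by omega)
    have hP : ((N + 1).choose (r + 1) : ℚ) = N.choose r + N.choose (r + 1) := by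
      rw [Nat.choose_succ_succ, Nat.cast_add]
    obtain _ | b := b
    · rw [grDd_right_zero, finrank_gr_cast, hP]
      simp only [Nat.choose_zero_right, Nat.cast_zero, Nat.cast_add, Nat.cast_one]
      linear_combination -((N + a).choose a : ℚ) * hC
    · have hsum : (Module.finrank ℂ (grDd (N + 1) a (b + 1) (r + 1)) : ℚ) +
          Module.finrank ℂ (grDd (N + 1) a b r) =
            Module.finrank ℂ (gr (N + 1) a (b + 1) (r + 1)) := by
        exact_mod_cast finrank_inf_ker_add _ (map_opDd_gr a b (show r < N + 1 by omega))
      have h := ih b (by omega)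
      rw [finrank_gr_cast, hP] at hsum
      have hb := choose_succ_cast N b
      push_cast at hsum ⊢
      linear_combination ((b : ℚ) + N + 1 - r) * hsum - h -
        ((N + a).choose a : ℚ) * ((N + (b + 1)).choose (b + 1)) * hC +
        ((N + a).choose a : ℚ) * N.choose r * hb

lemma finrank_grHM_top_zero (N a : ℕ) :
    (Module.finrank ℂ (grHM (N + 1) a 0 (N + 1)) : ℚ) = (N + a).choose a := by
  rw [grHM_top, grDd_right_zero, finrank_gr_cast]
  simp

lemma finrank_grHM_top_succ (N a b : ℕ) :
    (Module.finrank ℂ (grHM (N + 1) a (b + 1) (N + 1)) : ℚ) = 0 := by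
  have h := finrank_grDd a (b + 1) (le_refl (N + 1))
  rw [grHM_top]
  rw [Nat.choose_succ_self, Nat.cast_zero, mul_zero] at h
  refine (mul_eq_zero.1 h).resolve_left ?_
  push_cast
  rw [show (b : ℚ) + 1 + N + 1 - (N + 1) = b + 1 by ring]
  positivity

lemma finrank_grHM_add (n a b r : ℕ) : (Module.finrank ℂ (grHM n (a + 1) b r) : ℚ) +
    Module.finrank ℂ (grHM n a b (r + 1)) = Module.finrank ℂ (grDdLap n (a + 1) b r) := by
  rw [grHM_eq_inf n (a + 1)]
  exact_mod_cast finrank_inf_ker_add _ (map_opD_grDdLap n a b r)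

lemma finrank_grDdLap_add {n r : ℕ} (a b : ℕ) (hr : r < n) :
    (Module.finrank ℂ (grDdLap n (a + 1) (b + 1) r) : ℚ) + Module.finrank ℂ (grDd n a b r) =
      Module.finrank ℂ (grDd n (a + 1) (b + 1) r) := by
  exact_mod_cast finrank_inf_ker_add _ (map_lap_grDd a b hr)

lemma finrank_grHM {N r : ℕ} (a b : ℕ) (hr : r ≤ N) :
    ((a : ℚ) + r) * (b + N + 1 - r) * Module.finrank ℂ (grHM (N + 1) a b r) =
      (a + b + N + 1) * r * N.choose r * (N + a).choose a * (N + b).choose b := by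
  induction a generalizing r with
  | zero =>
    have h := finrank_grDd 0 b (show r ≤ N + 1 by omega)
    rw [grHM_left_zero]
    push_cast
    linear_combination (r : ℚ) * h
  | succ a ih =>
    have hm := finrank_grHM_add (N + 1) a b r
    have ha := choose_succ_cast N a
    have hC := choose_succ_right_cast hr
    have hrN : (r : ℚ) ≤ N := by exact_mod_cast hr
    obtain _ | b := b
    · have hz := finrank_grDd (a + 1) 0 (show r ≤ N + 1 by omega)
      rw [grDdLap_right_zero] at hm
      have h1 : ((a : ℚ) + r + 1) * Module.finrank ℂ (grHM (N + 1) a 0 (r + 1)) =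
          (a + 1) * (N + (a + 1)).choose (a + 1) * N.choose r := by
        obtain rfl | hlt := hr.eq_or_lt
        · rw [finrank_grHM_top_zero, Nat.choose_self]
          push_cast
          linear_combination -ha
        · have h := ih (r := r + 1) hlt
          have hlt' : (r : ℚ) < N := by exact_mod_cast hlt
          refine mul_left_cancel₀ (sub_ne_zero.2 hlt'.ne') ?_
          push_cast [Nat.choose_zero_right] at h
          linear_combination h + ((a : ℚ) + N + 1) * (N + a).choose a * hC -
            ((N : ℚ) - r) * N.choose r * ha
      push_cast [Nat.choose_zero_right] at hz ⊢
      linear_combination ((a : ℚ) + 1 + r) * (N + 1 - r) * hm + ((a : ℚ) + 1 + r) * hz -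
        ((N : ℚ) + 1 - r) * h1
    · have hk := finrank_grDdLap_add a b (show r < N + 1 by omega)
      have hz1 := finrank_grDd (a + 1) (b + 1) (show r ≤ N + 1 by omega)
      have hz0 := finrank_grDd a b (show r ≤ N + 1 by omega)
      have hb := choose_succ_cast N b
      have h1 : ((a : ℚ) + r + 1) * (b + 1 + N - r) *
          Module.finrank ℂ (grHM (N + 1) a (b + 1) (r + 1)) =
          (a + b + N + 2) * (N - r) * N.choose r * (N + a).choose a *
            (N + (b + 1)).choose (b + 1) := by
        obtain rfl | hlt := hr.eq_or_lt
        · rw [finrank_grHM_top_succ]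
          ring
        · have h := ih (r := r + 1) hlt
          push_cast at h
          linear_combination h + ((a : ℚ) + b + N + 2) * (N + a).choose a *
            (N + (b + 1)).choose (b + 1) * hC
      have hne : ((b : ℚ) + 1 + N - r) * (a + N + 1) ≠ 0 :=
        mul_ne_zero (ne_of_gt (by linarith [Nat.cast_nonneg (α := ℚ) b])) (by positivity)
      refine mul_left_cancel₀ hne ?_
      push_cast at hz1 hz0 ⊢
      set X : ℚ := ((a : ℚ) + 1 + r) * (b + 1 + N + 1 - r)
      linear_combination ((b : ℚ) + 1 + N - r) * (a + N + 1) * X * (hm + hk) +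
        ((b : ℚ) + 1 + N - r) * (a + N + 1) * (a + 1 + r) * hz1 - ((a : ℚ) + N + 1) * X * hz0 -
        ((a : ℚ) + N + 1) * (b + 1 + N + 1 - r) * h1 +
        ((a : ℚ) + N + 1) * X * (N + a).choose a * N.choose r * hb +
        X * N.choose r * (N + (b + 1)).choose (b + 1) * (b + 1) * ha +
        ((b : ℚ) + 1 + N + 1 - r) * (a + b + N + 2) * (N - r) * N.choose r *
          (N + (b + 1)).choose (b + 1) * ha

/-! ### Polynomials as functions -/

/-- The values of the variables `z_j` and `z_j^c` at a point. -/
def conjPoint {σ : Type*} (z : σ → ℂ) : σ ⊕ σ → ℂ :=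
  Sum.elim z (fun j => (starRingEnd ℂ) (z j))

/-- A polynomial in `z` and `z^c` that vanishes as a function is zero. -/
lemma eq_zero_of_eval_conjPoint {σ : Type*} {F : MvPolynomial (σ ⊕ σ) ℂ}
    (h : ∀ z : σ → ℂ, MvPolynomial.eval (conjPoint z) F = 0) : F = 0 := by
  let G : MvPolynomial (σ ⊕ σ) ℂ := MvPolynomial.bind₁ (Sum.elim
    (fun j => MvPolynomial.X (Sum.inl j) + MvPolynomial.C Complex.I * MvPolynomial.X (Sum.inr j))
    (fun j => MvPolynomial.X (Sum.inl j) - MvPolynomial.C Complex.I * MvPolynomial.X (Sum.inr j)))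
    F
  have hG : ∀ w : σ ⊕ σ → ℂ, MvPolynomial.eval w G = MvPolynomial.eval (Sum.elim
      (fun j => w (Sum.inl j) + Complex.I * w (Sum.inr j))
      (fun j => w (Sum.inl j) - Complex.I * w (Sum.inr j))) F := by
    intro w
    rw [MvPolynomial.eval, MvPolynomial.eval₂Hom_bind₁]
    congr 2
    ext (j | j) <;> simp
  have hG0 : G = 0 := by
    refine MvPolynomial.funext_set (fun _ => Set.range ((↑) : ℝ → ℂ))
      (fun _ => Set.infinite_range_of_injective Complex.ofReal_injective) fun w hw => ?_
    choose v hv using fun i => hw i (Set.mem_univ i)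
    rw [hG, map_zero, ← h (fun j => v (Sum.inl j) + Complex.I * v (Sum.inr j))]
    congr 2
    ext (j | j) <;> simp [conjPoint, ← hv, sub_eq_add_neg]
  refine MvPolynomial.funext fun w => ?_
  have := hG (Sum.elim (fun j => (w (Sum.inl j) + w (Sum.inr j)) / 2)
    (fun j => (w (Sum.inl j) - w (Sum.inr j)) / (2 * Complex.I)))
  rw [hG0, map_zero] at this
  rw [map_zero, this]
  congr 2
  ext (j | j) <;> simp <;> field_simp <;> ring

/-- The function defined by a polynomial with Clifford coefficients. -/
def evalMap (n : ℕ) : PolCl n →ₗ[ℂ] ((Fin n → ℂ) → Cl n) :=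
  LinearMap.pi fun z => (TensorProduct.lid ℂ (Cl n)).toLinearMap ∘ₗ
    TensorProduct.map (MvPolynomial.aeval (conjPoint z)).toLinearMap LinearMap.id

lemma evalMap_tmul {n : ℕ} (F : Pol n) (x : Cl n) (z : Fin n → ℂ) :
    evalMap n (F ⊗ₜ[ℂ] x) z = MvPolynomial.eval (conjPoint z) F • x := by
  simp [evalMap, MvPolynomial.aeval_eq_eval]

lemma evalMap_injective (n : ℕ) : Function.Injective (evalMap n) := by
  classical
  let B := Module.Basis.ofVectorSpace ℂ (Cl n)
  let E := TensorProduct.equivFinsuppOfBasisRight (M := Pol n) B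
  have key : ∀ u z i, MvPolynomial.eval (conjPoint z) (E u i) = B.repr (evalMap n u z) i := by
    intro u z i
    induction u using TensorProduct.induction_on with
    | zero => simp
    | tmul F x => simp [E, evalMap_tmul, mul_comm]
    | add u v hu hv => simp [hu, hv]
  refine (injective_iff_map_eq_zero _).2 fun u hu => E.map_eq_zero_iff.1 (Finsupp.ext fun i => ?_)
  exact eq_zero_of_eval_conjPoint fun z => by rw [key, hu]; simp

lemma hasDerivAt_eval {σ : Type*} [Fintype σ] (F : MvPolynomial σ ℂ) {γ : ℝ → σ → ℂ} {γ' : σ → ℂ}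
    {t : ℝ} (h : ∀ i, HasDerivAt (fun s => γ s i) (γ' i) t) :
    HasDerivAt (fun s => MvPolynomial.eval (γ s) F)
      (∑ i, γ' i * MvPolynomial.eval (γ t) (MvPolynomial.pderiv i F)) t := by
  classical
  induction F using MvPolynomial.induction_on with
  | C c => simpa using hasDerivAt_const t c
  | add F G hF hG =>
    simp only [map_add, mul_add, Finset.sum_add_distrib]
    exact hF.add hG
  | mul_X F i hF =>
    simp only [map_mul, MvPolynomial.eval_X]
    refine (hF.mul (h i)).congr_deriv ?_
    simp only [Derivation.leibniz, MvPolynomial.pderiv_X, smul_eq_mul, map_add, map_mul,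
      MvPolynomial.eval_X, mul_add, Finset.sum_add_distrib, Finset.sum_mul, Pi.single_apply,
      apply_ite (MvPolynomial.eval (γ t)), map_zero, mul_ite, mul_one, mul_zero,
      Finset.sum_ite_eq, Finset.mem_univ, if_true]
    rw [add_comm, mul_comm (γ' i)]
    exact congrArg _ (Finset.sum_congr rfl fun _ _ => by ring)

lemma hasDirDeriv_evalMap {n : ℕ} (u : PolCl n) (z v : Fin n → ℂ) :
    HasDirDeriv (evalMap n u) z v
      (∑ i, conjPoint v i • evalMap n (polOp (del i) u) z) := by
  intro φ
  induction u using TensorProduct.induction_on with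
  | zero => simpa using hasDerivAt_const (0 : ℝ) (0 : ℂ)
  | add u w hu hw =>
    simp only [map_add, Pi.add_apply, smul_add, Finset.sum_add_distrib]
    exact hu.add hw
  | tmul F x =>
    have hγ : ∀ i, HasDerivAt (fun s : ℝ => conjPoint (z + s • v) i) (conjPoint v i) 0 := by
      rintro (j | j)
      · simpa [conjPoint] using (((hasDerivAt_id (0 : ℝ)).ofReal_comp).mul_const
          (v j)).const_add (z j)
      · simpa [conjPoint] using (((hasDerivAt_id (0 : ℝ)).ofReal_comp).mul_const
          ((starRingEnd ℂ) (v j))).const_add ((starRingEnd ℂ) (z j))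
    have := (hasDerivAt_eval F hγ).mul_const (φ x)
    simp only [evalMap_tmul, polOp_tmul, del_apply, map_sum, map_smul, smul_eq_mul, ← mul_assoc,
      ← Finset.sum_mul]
    simpa only [zero_smul, add_zero] using this

lemma HasDirDeriv.unique {n m : ℕ} {f : (Fin m → ℂ) → Cl n} {z v : Fin m → ℂ} {d d' : Cl n}
    (h : HasDirDeriv f z v d) (h' : HasDirDeriv f z v d') : d = d' := by
  rw [← sub_eq_zero, ← Module.forall_dual_apply_eq_zero_iff ℂ]
  intro φ
  rw [map_sub, (h φ).unique (h' φ), sub_self]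

lemma dirDeriv_evalMap {n : ℕ} (u : PolCl n) (v z : Fin n → ℂ) :
    dirDeriv (evalMap n u) v z = ∑ i, conjPoint v i • evalMap n (polOp (del i) u) z := by
  have h := hasDirDeriv_evalMap u z v
  exact (Classical.epsilon_spec (p := HasDirDeriv (evalMap n u) z v) ⟨_, h⟩).unique h

lemma dirDeriv_evalMap_single {n : ℕ} (u : PolCl n) (j : Fin n) (c : ℂ) (z : Fin n → ℂ) :
    dirDeriv (evalMap n u) (Pi.single j c) z =
      c • evalMap n (polOp (del (Sum.inl j)) u) z +
        (starRingEnd ℂ) c • evalMap n (polOp (del (Sum.inr j)) u) z := by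
  rw [dirDeriv_evalMap, Fintype.sum_sum_type]
  simp [conjPoint, Pi.single_apply, apply_ite (starRingEnd ℂ)]

lemma pz_evalMap {n : ℕ} (u : PolCl n) (j : Fin n) :
    pz j (evalMap n u) = evalMap n (polOp (del (Sum.inl j)) u) := by
  ext z
  simp only [pz, dirDeriv_evalMap_single]
  simp only [map_one, one_smul, Complex.conj_I, neg_smul, smul_add, smul_neg, smul_smul,
    Complex.I_mul_I]
  module

lemma pzc_evalMap {n : ℕ} (u : PolCl n) (j : Fin n) :
    pzc j (evalMap n u) = evalMap n (polOp (del (Sum.inr j)) u) := by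
  ext z
  simp only [pzc, dirDeriv_evalMap_single]
  simp only [map_one, one_smul, Complex.conj_I, neg_smul, smul_add, smul_neg, smul_smul,
    Complex.I_mul_I]
  module

lemma evalMap_cliffOp {n : ℕ} (T : Fin n → Module.End ℂ (Pol n)) (v : Fin n → Cl n) (u : PolCl n)
    (z : Fin n → ℂ) :
    evalMap n (cliffOp T v u) z = ∑ j, v j * evalMap n (polOp (T j) u) z := by
  induction u using TensorProduct.induction_on with
  | zero => simp
  | tmul F x => simp [cliffOp_tmul, polOp_tmul, evalMap_tmul, Finset.sum_apply]
  | add u w hu hw => simp [hu, hw, mul_add, Finset.sum_add_distrib]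

lemma hMonogenic_evalMap {n : ℕ} {u : PolCl n} :
    HMonogenic n (evalMap n u) ↔ opD n u = 0 ∧ opDd n u = 0 := by
  have hD : dzFull n (evalMap n u) = evalMap n (opD n u) := by
    ext z
    simp only [dzFull, pz_evalMap, opD, evalMap_cliffOp]
  have hDd : dzdFull n (evalMap n u) = evalMap n (opDd n u) := by
    ext z
    simp only [dzdFull, pzc_evalMap, opDd, evalMap_cliffOp]
  rw [HMonogenic, hD, hDd, forall_and, ← map_eq_zero_iff _ (evalMap_injective n),
    ← map_eq_zero_iff _ (evalMap_injective n), funext_iff, funext_iff]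
  rfl

lemma eval_monomial_conjPoint {n : ℕ} (d : Fin n ⊕ Fin n →₀ ℕ) (c : ℂ) (z : Fin n → ℂ) :
    MvPolynomial.eval (conjPoint z) (MvPolynomial.monomial d c) =
      c * ∏ j, (z j ^ d (Sum.inl j) * (starRingEnd ℂ) (z j) ^ d (Sum.inr j)) := by
  rw [MvPolynomial.eval_monomial, Finsupp.prod_fintype _ _ (by simp), Fintype.prod_sum_type,
    Finset.prod_mul_distrib]
  rfl

lemma prod_smul_pow {m : ℕ} (c : ℂ) (z : Fin m → ℂ) (α β : Fin m → ℕ) :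
    ∏ j, ((c • z) j ^ α j * (starRingEnd ℂ) ((c • z) j) ^ β j) =
      c ^ (∑ j, α j) * (starRingEnd ℂ) c ^ (∑ j, β j) *
        ∏ j, (z j ^ α j * (starRingEnd ℂ) (z j) ^ β j) := by
  simp only [Pi.smul_apply, smul_eq_mul, map_mul, mul_pow, Finset.prod_mul_distrib,
    Finset.prod_pow_eq_pow_sum]
  ring

lemma evalMap_mem_Lam {n a b r : ℕ} {u : PolCl n} (hu : u ∈ gr n a b r) (z : Fin n → ℂ) :
    evalMap n u z ∈ Lam n r :=
  gr_induction (f := LinearMap.proj z ∘ₗ evalMap n) (fun F _ x hx => by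
    simpa [evalMap_tmul] using Submodule.smul_mem _ _ hx) u hu

lemma isBihom_evalMap {n a b r : ℕ} {u : PolCl n} (hu : u ∈ gr n a b r) :
    IsBihom n n a b (evalMap n u) := by
  rw [gr_eq_span, Submodule.mem_span_range_iff_exists_fun] at hu
  obtain ⟨c, rfl⟩ := hu
  have hval : ∀ i z, evalMap n (grBasis n a b r i) z =
      (∏ j, (z j ^ i.1.1 j * (starRingEnd ℂ) (z j) ^ i.2.1.1 j)) • blade n i.2.2.1 := by
    intro i z
    rw [grBasis, evalMap_tmul, eval_monomial_conjPoint, one_mul]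
    simp only [Finsupp.sumElim_inl, Finsupp.sumElim_inr]
  constructor
  · let ε := (Fintype.equivFin (Finset.finsuppAntidiag (Finset.univ : Finset (Fin n)) a ×
      Finset.finsuppAntidiag (Finset.univ : Finset (Fin n)) b ×
      Finset.powersetCard r (Finset.univ : Finset (Fin n)))).symm
    refine ⟨_, fun t => c (ε t) • blade n (ε t).2.2.1, fun t => (ε t).1.1, fun t => (ε t).2.1.1,
      fun z => ?_⟩
    simp only [map_sum, map_smul, Finset.sum_apply, Pi.smul_apply, hval]
    rw [← ε.sum_comp]
    exact Finset.sum_congr rfl fun t _ => smul_comm _ _ _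
  · intro w z
    simp only [map_sum, map_smul, Finset.sum_apply, Finset.smul_sum]
    refine Finset.sum_congr rfl fun i _ => ?_
    have h1 : ∑ j, i.1.1 j = a := (Finset.mem_finsuppAntidiag.1 i.1.2).1
    have h2 : ∑ j, i.2.1.1 j = b := (Finset.mem_finsuppAntidiag.1 i.2.1.2).1
    rw [Pi.smul_apply, Pi.smul_apply, hval, hval, prod_smul_pow, h1, h2, mul_smul, smul_comm (c i)]

lemma sum_eq_of_bihom {N : ℕ} {α β : Fin N → ℕ} {w : Fin N → ℂ} {a b : ℕ} {q : ℂ}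
    (h : ∀ c : ℂ, ∑ t, c ^ α t * (starRingEnd ℂ) c ^ β t * w t =
      c ^ a * (starRingEnd ℂ) c ^ b * q) :
    ∑ t with α t = a ∧ β t = b, w t = q := by
  let δ : ℕ → ℕ → (Unit ⊕ Unit →₀ ℕ) := fun i j =>
    Finsupp.sumElim (Finsupp.single () i) (Finsupp.single () j)
  have hδ : ∀ i j i' j', δ i j = δ i' j' ↔ i = i' ∧ j = j' := by
    refine fun i j i' j' => ⟨fun hij => ⟨?_, ?_⟩, by rintro ⟨rfl, rfl⟩; rfl⟩
    · simpa [δ] using DFunLike.congr_fun hij (Sum.inl ())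
    · simpa [δ] using DFunLike.congr_fun hij (Sum.inr ())
  have hF : ∑ t, MvPolynomial.monomial (δ (α t) (β t)) (w t) - MvPolynomial.monomial (δ a b) q =
      0 := by
    refine eq_zero_of_eval_conjPoint fun c => ?_
    have hm : ∀ i j y, MvPolynomial.eval (conjPoint c) (MvPolynomial.monomial (δ i j) y) =
        c () ^ i * (starRingEnd ℂ) (c ()) ^ j * y := by
      intro i j y
      rw [MvPolynomial.eval_monomial, Finsupp.prod_fintype _ _ (by simp), Fintype.prod_sum_type]
      simp [δ, conjPoint, mul_comm]
    simp only [map_sub, map_sum, hm, h, sub_self]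
  have := congrArg (MvPolynomial.coeff (δ a b)) hF
  simp only [MvPolynomial.coeff_sub, MvPolynomial.coeff_sum, MvPolynomial.coeff_monomial, hδ,
    if_true, MvPolynomial.coeff_zero, sub_eq_zero] at this
  rw [Finset.sum_filter, this]

lemma exists_evalMap_eq {n a b r : ℕ} {p : (Fin n → ℂ) → Cl n} (hp : IsBihom n n a b p)
    (hLam : ∀ z, p z ∈ Lam n r) : ∃ u ∈ gr n a b r, evalMap n u = p := by
  obtain ⟨⟨N, c, dx, dy, hc⟩, hhom⟩ := hp
  obtain ⟨π, hπ⟩ := LinearMap.exists_leftInverse_of_injective (Lam n r).subtype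
    (Submodule.ker_subtype _)
  have hπp : ∀ x ∈ Lam n r, (π x : Cl n) = x := fun x hx =>
    congrArg Subtype.val (LinearMap.congr_fun hπ ⟨x, hx⟩)
  refine ⟨∑ t with ∑ j, dx t j = a ∧ ∑ j, dy t j = b,
    MvPolynomial.monomial (Finsupp.sumElim (Finsupp.equivFunOnFinite.symm (dx t))
      (Finsupp.equivFunOnFinite.symm (dy t))) 1 ⊗ₜ[ℂ] (π (c t) : Cl n), ?_, ?_⟩
  · refine Submodule.sum_mem _ fun t ht => tmul_mem_gr ?_ (π (c t)).2
    rw [biPol_eq_span]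
    exact Submodule.subset_span ⟨_, by simpa using ht, rfl⟩
  · ext z
    have key : ∑ t with ∑ j, dx t j = a ∧ ∑ j, dy t j = b,
        (∏ j, (z j ^ dx t j * (starRingEnd ℂ) (z j) ^ dy t j)) • c t = p z := by
      rw [← sub_eq_zero, ← Module.forall_dual_apply_eq_zero_iff ℂ]
      intro φ
      rw [map_sub, sub_eq_zero, map_sum]
      refine sum_eq_of_bihom fun y => ?_
      have := congrArg φ (hhom y z)
      rw [hc (y • z)] at this
      simpa only [map_sum, map_smul, prod_smul_pow, smul_eq_mul, mul_assoc] using this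
    rw [← hπp _ (hLam z), ← key]
    simp [evalMap_tmul, eval_monomial_conjPoint]

lemma exists_fin_basis {V : Type*} [AddCommGroup V] [Module ℂ V] (S : Submodule ℂ V)
    [FiniteDimensional ℂ S] : ∃ g : Fin (Module.finrank ℂ S) → V,
      LinearIndependent ℂ g ∧ Submodule.span ℂ (Set.range g) = S := by
  let B := Module.finBasis ℂ S
  refine ⟨fun t => B t, B.linearIndependent.map' _ (Submodule.ker_subtype _), ?_⟩
  have h : Set.range (fun t => (B t : V)) = S.subtype '' Set.range B := by
    rw [← Set.range_comp]
    rfl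
  rw [h, Submodule.span_image, B.span_eq, Submodule.map_subtype_top]

end

/-- **Dimension of the space `ℋℳ^{(r)}_{a,b}` of spherical Hermitean monogenics:** the space
of Hermitean monogenic homogeneous polynomials of bidegree `(a,b)` from `ℂⁿ` to
`(∧_n†)^{(r)} I` has dimension
`m^{(r)}_{a,b} = ((a+b+n) r / ((a+r)(b+n-r))) C(n-1,r) C(a+n-1,a) C(b+n-1,b)`,
witnessed by a spanning linearly independent family of that cardinality. -/
theorem dim_spherical_hermitean_monogenics (n : ℕ) (hn : 2 ≤ n) (a b r : ℕ)
    (hr0 : 0 < r) (hrn : r < n) :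
    ∃ d : ℕ,
      (d : ℚ) = ((a : ℚ) + b + n) * r / ((((a : ℚ) + r)) * ((b : ℚ) + n - r)) *
        (Nat.choose (n - 1) r : ℚ) * (Nat.choose (a + n - 1) a : ℚ) *
        (Nat.choose (b + n - 1) b : ℚ) ∧
      ∃ g : Fin d → ((Fin n → ℂ) → Cl n),
        (∀ t, IsBihom n n a b (g t) ∧ (∀ z, g t z ∈ Lam n r) ∧ HMonogenic n (g t)) ∧
        LinearIndependent ℂ g ∧
        ∀ p : (Fin n → ℂ) → Cl n,
          (IsBihom n n a b p ∧ (∀ z, p z ∈ Lam n r) ∧ HMonogenic n p) →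
            p ∈ Submodule.span ℂ (Set.range g) := by
  obtain ⟨N, rfl⟩ : ∃ N, n = N + 1 := ⟨n - 1, by omega⟩
  obtain ⟨g, hg, hspan⟩ := exists_fin_basis (grHM (N + 1) a b r)
  refine ⟨_, ?_, fun t => evalMap (N + 1) (g t), fun t => ?_,
    hg.map' _ (LinearMap.ker_eq_bot.2 (evalMap_injective _)), fun p hp => ?_⟩
  · have h := finrank_grHM a b (show r ≤ N by omega)
    have hrN : (r : ℚ) < N + 1 := by exact_mod_cast hrn
    have h1 : (a : ℚ) + r ≠ 0 := by positivity
    have h2 : (b : ℚ) + N + 1 - r ≠ 0 := ne_of_gt (by linarith [Nat.cast_nonneg (α := ℚ) b])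
    rw [show a + (N + 1) - 1 = N + a by omega, show b + (N + 1) - 1 = N + b by omega,
      Nat.add_sub_cancel]
    push_cast
    rw [← add_assoc (_ + _) (N : ℚ), ← add_assoc (b : ℚ), div_mul_eq_mul_div, div_mul_eq_mul_div,
      div_mul_eq_mul_div, eq_div_iff (mul_ne_zero h1 h2), ← h]
    ring
  · have hB : g t ∈ grHM (N + 1) a b r := hspan ▸ Submodule.subset_span ⟨t, rfl⟩
    exact ⟨isBihom_evalMap hB.1.1, evalMap_mem_Lam hB.1.1, hMonogenic_evalMap.2 ⟨hB.2, hB.1.2⟩⟩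
  · obtain ⟨u, hu, rfl⟩ := exists_evalMap_eq hp.1 hp.2.1
    obtain ⟨hD, hDd⟩ := hMonogenic_evalMap.1 hp.2.2
    have hu' : u ∈ grHM (N + 1) a b r := ⟨⟨hu, hDd⟩, hD⟩
    rw [← hspan] at hu'
    have h := Submodule.mem_map_of_mem (f := evalMap (N + 1)) hu'
    rw [Submodule.map_span, ← Set.range_comp] at h
    exact h
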